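/- arXiv:1308.3112 — 2 statements merged into one kernel-verified Lean document; each statement's English description precedes it below -/
import Mathlib

section
/- Let r ≥ 1 be an integer. For each n ≥ 1 let f be a uniformly distributed random Boolean function on 𝔽₂ⁿ, and let E[N_r(f)] denote the expectation of its r-th order nonlinearity. Then (2^{n−1} − E[N_r(f)]) / √(2^{n−1}·C(n,r)·log 2) → 1 as n → ∞. -/
open MeasureTheory ProbabilityTheory Filter Real

noncomputable section
/-- Boolean functions on `𝔽₂ⁿ`. -/
abbrev BF (n : ℕ) := (Fin n → ZMod 2) → ZMod 2

/-- Hamming distance between Boolean functions. -/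
def hdist {n : ℕ} (f g : BF n) : ℕ := Nat.card {x : Fin n → ZMod 2 | f x ≠ g x}

/-- Weight of a Boolean function. -/
def wt {n : ℕ} (g : BF n) : ℕ := Nat.card {x : Fin n → ZMod 2 | g x ≠ 0}

/-- The Reed–Muller code `RM(r,n)`: Boolean functions of degree at most `r`. -/
def RM (r n : ℕ) : Set (BF n) :=
  {g | ∃ p : MvPolynomial (Fin n) (ZMod 2),
    p.totalDegree ≤ r ∧ ∀ x, MvPolynomial.eval x p = g x}

/-- The `r`-th order nonlinearity of a Boolean function. -/
def nonlin (r : ℕ) {n : ℕ} (f : BF n) : ℕ := sInf (hdist f '' RM r n)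

/-- Extend `x ∈ 𝔽₂ⁿ` to a finitely supported sequence `(x₁,…,xₙ,0,0,…)`. -/
def extend {n : ℕ} (x : Fin n → ZMod 2) : ℕ →₀ ZMod 2 :=
  ∑ i : Fin n, Finsupp.single (i : ℕ) (x i)
/-- The sign character of `𝔽₂`. -/
def sg (z : ZMod 2) : ℝ := if z = 0 then 1 else -1

lemma sg_zero : sg 0 = 1 := by simp [sg]
lemma sg_one : sg 1 = -1 := by simp [sg]

lemma zmod2_cases (z : ZMod 2) : z = 0 ∨ z = 1 := by
  revert z; decide

lemma sg_add (a b : ZMod 2) : sg (a + b) = sg a * sg b := by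
  have h11 : (1 : ZMod 2) + 1 = 0 := by decide
  rcases zmod2_cases a with rfl | rfl <;> rcases zmod2_cases b with rfl | rfl <;>
    simp [sg_zero, sg_one, h11]

lemma sg_sq (a : ZMod 2) : sg a * sg a = 1 := by
  rcases zmod2_cases a with rfl | rfl <;> simp [sg_zero, sg_one]

lemma sg_cases (a : ZMod 2) : sg a = 1 ∨ sg a = -1 := by
  rcases zmod2_cases a with rfl | rfl <;> simp [sg_zero, sg_one]

lemma sum_zmod2 (F : ZMod 2 → ℝ) : ∑ z, F z = F 0 + F 1 := by
  exact Fin.sum_univ_two F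

section generic

variable {ι : Type} [Fintype ι] [DecidableEq ι]

/-- Expectation over uniformly random functions `ι → 𝔽₂`. -/
def Ex (φ : (ι → ZMod 2) → ℝ) : ℝ := (∑ f, φ f) / 2 ^ (Fintype.card ι)

/-- Correlation. -/
def Yc (f g : ι → ZMod 2) : ℝ := ∑ x, sg (f x + g x)

lemma Ex_mono {φ ψ : (ι → ZMod 2) → ℝ} (h : ∀ f, φ f ≤ ψ f) : Ex φ ≤ Ex ψ := by
  unfold Ex
  gcongr with f
  exact h f

lemma Ex_const (c : ℝ) : Ex (fun _ : ι → ZMod 2 => c) = c := by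
  unfold Ex
  simp [ZMod.card]

lemma Ex_add (φ ψ : (ι → ZMod 2) → ℝ) : Ex (fun f => φ f + ψ f) = Ex φ + Ex ψ := by
  unfold Ex
  rw [Finset.sum_add_distrib, add_div]

lemma Ex_mul (c : ℝ) (φ : (ι → ZMod 2) → ℝ) : Ex (fun f => c * φ f) = c * Ex φ := by
  unfold Ex
  rw [← Finset.mul_sum, mul_div_assoc]

lemma Ex_sum {α : Type} (s : Finset α) (φ : α → (ι → ZMod 2) → ℝ) :
    Ex (fun f => ∑ a ∈ s, φ a f) = ∑ a ∈ s, Ex (φ a) := by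
  unfold Ex
  rw [Finset.sum_comm, Finset.sum_div]

lemma Ex_sub (φ ψ : (ι → ZMod 2) → ℝ) : Ex (fun f => φ f - ψ f) = Ex φ - Ex ψ := by
  unfold Ex
  rw [Finset.sum_sub_distrib, sub_div]

lemma Ex_nonneg {φ : (ι → ZMod 2) → ℝ} (h : ∀ f, 0 ≤ φ f) : 0 ≤ Ex φ := by
  have := Ex_mono (φ := fun _ => 0) (ψ := φ) h
  rwa [Ex_const] at this

lemma Ex_mgf (a : ι → ℝ) : Ex (fun f => Real.exp (∑ x, a x * sg (f x))) = ∏ x, Real.cosh (a x) := by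
  unfold Ex
  have h := Finset.prod_univ_sum (fun _ : ι => (Finset.univ : Finset (ZMod 2)))
    (fun x z => Real.exp (a x * sg z))
  rw [Fintype.piFinset_univ] at h
  simp_rw [Real.exp_sum]
  rw [← h]
  have : ∀ x, ∑ z, Real.exp (a x * sg z) = 2 * Real.cosh (a x) := by
    intro x
    rw [sum_zmod2, Real.cosh_eq]
    simp [sg_zero, sg_one]
    ring
  simp_rw [this]
  rw [Finset.prod_mul_distrib]
  simp

lemma Ex_mgf_le (a : ι → ℝ) :
    Ex (fun f => Real.exp (∑ x, a x * sg (f x))) ≤ Real.exp (∑ x, (a x)^2 / 2) := by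
  rw [Ex_mgf, Real.exp_sum]
  apply Finset.prod_le_prod
  · intro i _; exact (Real.cosh_pos _).le
  · intro i _; exact Real.cosh_le_exp_half_sq _

lemma Ex_mgf_single (β : ℝ) (g : ι → ZMod 2) :
    Ex (fun f => Real.exp (β * Yc f g)) = Real.cosh β ^ (Fintype.card ι) := by
  have h := Ex_mgf (fun x => β * sg (g x))
  have h2 : ∀ x, Real.cosh (β * sg (g x)) = Real.cosh β := by
    intro x
    rcases sg_cases (g x) with h | h <;> simp [h]
  simp only [h2, Finset.prod_const, Finset.card_univ] at h
  rw [← h]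
  congr 1
  ext f
  unfold Yc
  rw [Finset.mul_sum]
  congr 1
  apply Finset.sum_congr rfl
  intro x _
  rw [sg_add]; ring

lemma Ex_mgf_single_le (β : ℝ) (g : ι → ZMod 2) :
    Ex (fun f => Real.exp (β * Yc f g)) ≤ Real.exp ((Fintype.card ι) * (β ^ 2 / 2)) := by
  rw [Ex_mgf_single, Real.exp_nat_mul]
  exact pow_le_pow_left₀ (Real.cosh_pos _).le (Real.cosh_le_exp_half_sq _) _

lemma Ex_mgf_pair (γ : ℝ) (g h : ι → ZMod 2) :
    Ex (fun f => Real.exp (γ * (Yc f g + Yc f h)))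
      ≤ Real.exp (γ ^ 2 * (Fintype.card ι + Yc g h)) := by
  have := Ex_mgf_le (fun x => γ * (sg (g x) + sg (h x)))
  convert this using 2
  · ext f
    unfold Yc
    rw [← Finset.sum_add_distrib, Finset.mul_sum]
    congr 1
    apply Finset.sum_congr rfl
    intro x _
    rw [sg_add, sg_add]; ring
  · unfold Yc
    have h1 : ∀ x, (γ * (sg (g x) + sg (h x)))^2/2 = γ^2 * (1 + sg (g x + h x)) := by
      intro x
      rw [sg_add]
      linear_combination γ^2/2 * (sg_sq (g x)) + γ^2/2 * (sg_sq (h x))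
    simp_rw [h1]
    rw [← Finset.mul_sum, Finset.sum_add_distrib]
    simp

/-- Jensen. -/
lemma exp_Ex_le (φ : (ι → ZMod 2) → ℝ) : Real.exp (Ex φ) ≤ Ex (fun f => Real.exp (φ f)) := by
  have h : ∀ f, Real.exp (Ex φ) * (1 + (φ f - Ex φ)) ≤ Real.exp (φ f) := by
    intro f
    have h1 := Real.add_one_le_exp (φ f - Ex φ)
    have : Real.exp (φ f) = Real.exp (Ex φ) * Real.exp (φ f - Ex φ) := by
      rw [← Real.exp_add]; congr 1; ring
    rw [this]
    gcongr
    linarith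
  have h2 := Ex_mono h
  rw [Ex_mul, Ex_add, Ex_sub, Ex_const, Ex_const] at h2
  simpa using h2

/-- Maximal correlation. -/
def Mx (G : Finset (ι → ZMod 2)) (hG : G.Nonempty) (f : ι → ZMod 2) : ℝ :=
  G.sup' hG (fun g => Yc f g)

lemma massart (G : Finset (ι → ZMod 2)) (hG : G.Nonempty) (s : ℝ) :
    s * Ex (Mx G hG) ≤ Real.log G.card + (Fintype.card ι) * (s^2/2) := by
  have h1 : Real.exp (s * Ex (Mx G hG)) ≤ G.card * Real.exp ((Fintype.card ι) * (s^2/2)) := by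
    rw [← Ex_mul]
    refine (exp_Ex_le _).trans ?_
    have h2 : ∀ f, Real.exp (s * Mx G hG f) ≤ ∑ g ∈ G, Real.exp (s * Yc f g) := by
      intro f
      obtain ⟨g, hg, h⟩ := Finset.exists_mem_eq_sup' hG (fun g => Yc f g)
      unfold Mx
      rw [h]
      exact Finset.single_le_sum (f := fun g => Real.exp (s * Yc f g))
        (fun i _ => (Real.exp_pos _).le) hg
    refine (Ex_mono h2).trans ?_
    rw [Ex_sum]
    refine (Finset.sum_le_sum (fun g _ => Ex_mgf_single_le s g)).trans ?_
    simp
  have hc : (0:ℝ) < G.card := by exact_mod_cast hG.card_pos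
  have h3 := Real.log_le_log (Real.exp_pos _) h1
  rwa [Real.log_exp, Real.log_mul hc.ne' (Real.exp_pos _).ne', Real.log_exp] at h3

lemma massart' (G : Finset (ι → ZMod 2)) (hG : G.Nonempty) (D : ℝ) (hD : Real.log G.card ≤ D)
    (hD0 : 0 < D) (hN : 0 < Fintype.card ι) :
    Ex (Mx G hG) ≤ Real.sqrt (2 * Fintype.card ι * D) := by
  set N : ℝ := (Fintype.card ι : ℝ) with hNdef
  have hN' : 0 < N := by rw [hNdef]; exact_mod_cast hN
  set w := Real.sqrt (2 * N * D) with hw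
  have hw2 : w ^ 2 = 2 * N * D := Real.sq_sqrt (by positivity)
  have hwpos : 0 < w := Real.sqrt_pos.mpr (by positivity)
  have h := massart G hG (w / N)
  rw [← hNdef] at h
  have h2 : w / N * Ex (Mx G hG) ≤ w / N * w := by
    refine h.trans ?_
    have : N * ((w/N)^2/2) = D := by
      field_simp
      linarith
    rw [this]
    have : w / N * w = 2 * D := by
      field_simp
      linarith
    linarith
  exact le_of_mul_le_mul_left h2 (by positivity)

/-- Bounded-differences concentration, mgf version. -/
lemma mgf_conc (m : ℕ) : ∀ (F : (Fin m → ZMod 2) → ℝ),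
    (∀ f i z, |F (Function.update f i z) - F f| ≤ 2) → ∀ s : ℝ,
    Ex (fun f => Real.exp (s * F f)) ≤ Real.exp (s * Ex F + m * (s^2/2)) := by
  induction m with
  | zero =>
    intro F _ s
    unfold Ex
    simp
  | succ m ih =>
    intro F hF s
    have hsplit : ∀ φ : (Fin (m+1) → ZMod 2) → ℝ,
        Ex φ = (Ex (fun f : Fin m → ZMod 2 => φ (Fin.cons 0 f))
          + Ex (fun f : Fin m → ZMod 2 => φ (Fin.cons 1 f))) / 2 := by
      intro φ
      unfold Ex
      rw [← (Fin.consEquiv (fun _ : Fin (m+1) => ZMod 2)).sum_comp, Fintype.sum_prod_type, sum_zmod2]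
      simp only [Fintype.card_fin]
      have hc : ∀ z : ZMod 2, ∀ y : Fin m → ZMod 2,
          (Fin.consEquiv (fun _ : Fin (m+1) => ZMod 2)) (z, y) = Fin.cons z y := fun _ _ => rfl
      simp_rw [hc]
      rw [pow_succ]
      field_simp
    have hL : ∀ z : ZMod 2, ∀ f : Fin m → ZMod 2, ∀ i w,
        |F (Fin.cons z (Function.update f i w)) - F (Fin.cons z f)| ≤ 2 := by
      intro z f i w
      have := hF (Fin.cons z f) i.succ w
      rwa [← Fin.cons_update] at this
    have h0 := ih (fun f => F (Fin.cons 0 f)) (hL 0) s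
    have h1 := ih (fun f => F (Fin.cons 1 f)) (hL 1) s
    set A := Ex (fun f : Fin m → ZMod 2 => F (Fin.cons 0 f)) with hA
    set B := Ex (fun f : Fin m → ZMod 2 => F (Fin.cons 1 f)) with hB
    have hd : ∀ f : Fin m → ZMod 2, |F (Fin.cons 1 f) - F (Fin.cons 0 f)| ≤ 2 := by
      intro f
      have := hF (Fin.cons 0 f) 0 1
      rwa [Fin.update_cons_zero] at this
    have hAB : |B - A| ≤ 2 := by
      rw [hA, hB, ← Ex_sub, abs_le]
      constructor
      · have := Ex_mono (fun f => (abs_le.mp (hd f)).1)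
        rwa [Ex_const] at this
      · have := Ex_mono (fun f => (abs_le.mp (hd f)).2)
        rwa [Ex_const] at this
    rw [hsplit, hsplit F, ← hA, ← hB]
    have key : (Real.exp (s * A) + Real.exp (s * B)) / 2 ≤ Real.exp (s * ((A + B)/2) + s^2/2) := by
      have e1 : (Real.exp (s * A) + Real.exp (s * B)) / 2
          = Real.exp (s * ((A + B)/2)) * Real.cosh (s * (B - A)/2) := by
        rw [Real.cosh_eq, mul_div_assoc', mul_add, ← Real.exp_add, ← Real.exp_add, add_comm]
        congr 3 <;> ring
      rw [e1, Real.exp_add]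
      gcongr
      refine (Real.cosh_le_exp_half_sq _).trans ?_
      apply Real.exp_le_exp.mpr
      have : (B - A)^2 ≤ 4 := by
        have := sq_le_sq' (abs_le.mp hAB).1 (abs_le.mp hAB).2
        linarith
      have := mul_le_mul_of_nonneg_left this (sq_nonneg s)
      nlinarith
    calc _ ≤ (Real.exp (s * A + m * (s^2/2)) + Real.exp (s * B + m * (s^2/2))) / 2 := by
            linarith
      _ = (Real.exp (s * A) + Real.exp (s * B)) / 2 * Real.exp (m * (s^2/2)) := by
            rw [Real.exp_add, Real.exp_add]; ring
      _ ≤ Real.exp (s * ((A + B)/2) + s^2/2) * Real.exp (m * (s^2/2)) := by gcongr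
      _ = _ := by
            rw [← Real.exp_add]
            congr 1
            push_cast
            ring

lemma mgf_conc' (F : (ι → ZMod 2) → ℝ)
    (hF : ∀ f i z, |F (Function.update f i z) - F f| ≤ 2) (s : ℝ) :
    Ex (fun f => Real.exp (s * F f)) ≤ Real.exp (s * Ex F + (Fintype.card ι) * (s^2/2)) := by
  let e := Fintype.equivFin ι
  let E : (Fin (Fintype.card ι) → ZMod 2) ≃ (ι → ZMod 2) := e.symm.arrowCongr (Equiv.refl _)
  have hE : ∀ φ : (ι → ZMod 2) → ℝ, Ex φ = Ex (fun f => φ (E f)) := by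
    intro φ
    unfold Ex
    rw [← E.sum_comp]
    simp
  rw [hE, hE F]
  apply mgf_conc
  intro f i z
  have h := hF (E f) (e.symm i) z
  have : Function.update (E f) (e.symm i) z = E (Function.update f i z) := by
    ext j
    simp only [E, Equiv.arrowCongr_apply, Function.comp, Equiv.refl_apply, Function.update_apply,
      Equiv.symm_symm, Equiv.eq_symm_apply]
  rwa [this] at h

lemma Yc_update (f g : ι → ZMod 2) (i : ι) (z : ZMod 2) :
    |Yc (Function.update f i z) g - Yc f g| ≤ 2 := by
  unfold Yc
  rw [← Finset.sum_sub_distrib, Finset.sum_eq_single i]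
  · rcases sg_cases (Function.update f i z i + g i) with h | h <;>
      rcases sg_cases (f i + g i) with h' | h' <;> rw [h, h'] <;> norm_num
  · intro j _ hj
    simp [Function.update_of_ne hj]
  · simp

lemma Mx_update (G : Finset (ι → ZMod 2)) (hG : G.Nonempty) (f : ι → ZMod 2) (i : ι) (z : ZMod 2) :
    |Mx G hG (Function.update f i z) - Mx G hG f| ≤ 2 := by
  unfold Mx
  rw [abs_le]
  constructor
  · rw [neg_le_sub_iff_le_add]
    apply Finset.sup'_le
    intro g hg
    have h1 := (abs_le.mp (Yc_update f g i z)).1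
    have h2 := Finset.le_sup' (fun g => Yc (Function.update f i z) g) hg
    linarith
  · rw [sub_le_iff_le_add']
    apply Finset.sup'_le
    intro g hg
    have h1 := (abs_le.mp (Yc_update f g i z)).2
    have h2 := Finset.le_sup' (fun g => Yc f g) hg
    linarith

open Classical in
/-- Probability. -/
def Pr (P : (ι → ZMod 2) → Prop) : ℝ := Ex (fun f => if P f then 1 else 0)

lemma Pr_nonneg (P : (ι → ZMod 2) → Prop) : 0 ≤ Pr P := by
  classical
  apply Ex_nonneg
  intro f
  split_ifs <;> norm_num

lemma Pr_mono {P Q : (ι → ZMod 2) → Prop} (h : ∀ f, P f → Q f) : Pr P ≤ Pr Q := by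
  classical
  apply Ex_mono
  intro f
  by_cases hP : P f
  · simp [hP, h f hP]
  · simp only [hP, if_false]; split_ifs <;> norm_num

lemma markov (P : (ι → ZMod 2) → Prop) (φ : (ι → ZMod 2) → ℝ) (c : ℝ)
    (h : ∀ f, P f → c ≤ φ f) : Pr P ≤ Real.exp (-c) * Ex (fun f => Real.exp (φ f)) := by
  classical
  unfold Pr
  rw [← Ex_mul]
  apply Ex_mono
  intro f
  split_ifs with hP
  · rw [← Real.exp_add]
    apply Real.one_le_exp
    linarith [h f hP]
  · positivity

lemma conc (G : Finset (ι → ZMod 2)) (hG : G.Nonempty) (u : ℝ) (hu : 0 < u)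
    (hN : 0 < Fintype.card ι) :
    Pr (fun f => Ex (Mx G hG) + u ≤ Mx G hG f) ≤ Real.exp (- (u^2 / (2 * Fintype.card ι))) := by
  set N : ℝ := (Fintype.card ι : ℝ) with hNdef
  have hN' : 0 < N := by rw [hNdef]; exact_mod_cast hN
  have h := markov (fun f => Ex (Mx G hG) + u ≤ Mx G hG f) (fun f => u / N * Mx G hG f)
    (u / N * (Ex (Mx G hG) + u)) (by
      intro f hf
      gcongr)
  refine h.trans ?_
  have h2 := mgf_conc' (Mx G hG) (Mx_update G hG) (u/N)
  calc _ ≤ _ := mul_le_mul_of_nonneg_left h2 (Real.exp_pos _).le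
    _ = _ := by
      rw [← Real.exp_add]
      congr 1
      rw [← hNdef]
      field_simp
      ring

lemma tail_lower (g : ι → ZMod 2) (β η T : ℝ) (hβ : 0 < β) (hη : 0 < η) (hη1 : η ≤ 1)
    (hT : T = Fintype.card ι * β^2) (hβ2 : β^2 ≤ η^2/2) (hT4 : 4 ≤ T * η^2) :
    Real.exp (-(T * (1/2 + 2*η))) ≤ Pr (fun f => (1-η) * β * Fintype.card ι ≤ Yc f g) := by
  classical
  set N : ℝ := (Fintype.card ι : ℝ) with hNdef
  have hTpos : 0 < T := by
    by_contra hneg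
    push Not at hneg
    nlinarith [sq_nonneg η]
  -- pointwise bound
  have hpt : ∀ f, Real.exp (-(T * (1+η))) * (Real.exp (β * Yc f g)
      - (Real.exp (-(η * β * (1+η) * β * N)) * Real.exp ((1+η)*β * Yc f g) +
         Real.exp (η * β * (1-η) * β * N) * Real.exp ((1-η)*β * Yc f g)))
      ≤ if (1-η) * β * N ≤ Yc f g then 1 else 0 := by
    intro f
    rw [← Real.exp_add, ← Real.exp_add]
    split_ifs with h
    · by_cases h2 : Yc f g ≤ (1+η)*β*N
      · have : Real.exp (-(T * (1+η))) * Real.exp (β * Yc f g) ≤ 1 := by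
          rw [← Real.exp_add]
          apply Real.exp_le_one_iff.mpr
          have := mul_le_mul_of_nonneg_left h2 hβ.le
          rw [hT]; nlinarith
        have h5 := mul_pos (Real.exp_pos (-(T * (1+η)))) (Real.exp_pos (-(η * β * (1+η) * β * N) + (1+η)*β * Yc f g))
        have h6 := mul_pos (Real.exp_pos (-(T * (1+η)))) (Real.exp_pos (η * β * (1-η) * β * N + (1-η)*β * Yc f g))
        nlinarith
      · push Not at h2
        refine le_trans ?_ zero_le_one
        apply mul_nonpos_of_nonneg_of_nonpos (Real.exp_pos _).le
        have h5 := Real.exp_pos (η * β * (1-η) * β * N + (1-η)*β * Yc f g)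
        have : Real.exp (β * Yc f g) ≤ Real.exp (-(η * β * (1+η) * β * N) + (1+η)*β * Yc f g) := by
          apply Real.exp_le_exp.mpr
          have := mul_le_mul_of_nonneg_left h2.le (mul_pos hη hβ).le
          nlinarith
        linarith
    · push Not at h
      apply mul_nonpos_of_nonneg_of_nonpos (Real.exp_pos _).le
      have h5 := Real.exp_pos (-(η * β * (1+η) * β * N) + (1+η)*β * Yc f g)
      have : Real.exp (β * Yc f g) ≤ Real.exp (η * β * (1-η) * β * N + (1-η)*β * Yc f g) := by
        apply Real.exp_le_exp.mpr
        have := mul_le_mul_of_nonneg_left h.le (mul_pos hη hβ).le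
        nlinarith
      linarith
  have hE := Ex_mono hpt
  rw [Ex_mul, Ex_sub, Ex_add, Ex_mul, Ex_mul] at hE
  refine le_trans ?_ hE
  have hA : Real.exp (-(η * β * (1+η) * β * N)) * Ex (fun f => Real.exp ((1+η)*β * Yc f g))
      ≤ Real.exp (T/2 - η^2 * T/2) := by
    refine (mul_le_mul_of_nonneg_left (Ex_mgf_single_le _ g) (Real.exp_pos _).le).trans ?_
    rw [← Real.exp_add, ← hNdef, hT]
    apply Real.exp_le_exp.mpr
    apply le_of_eq; ring
  have hB : Real.exp (η * β * (1-η) * β * N) * Ex (fun f => Real.exp ((1-η)*β * Yc f g))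
      ≤ Real.exp (T/2 - η^2 * T/2) := by
    refine (mul_le_mul_of_nonneg_left (Ex_mgf_single_le _ g) (Real.exp_pos _).le).trans ?_
    rw [← Real.exp_add, ← hNdef, hT]
    apply Real.exp_le_exp.mpr
    apply le_of_eq; ring
  have hC : Real.exp (T/2 - T * η^2/8) ≤ Ex (fun f => Real.exp (β * Yc f g)) := by
    rw [Ex_mgf_single]
    have h1 : Real.exp (β^2/2 * (1 - β^2/2)) ≤ Real.cosh β := by
      have hc : 1 + β^2/2 ≤ Real.cosh β := by
        have e1 : Real.cosh β = Real.cosh (2 * (β/2)) := by congr 1; ring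
        have e2 : β/2 ≤ Real.sinh (β/2) := Real.self_le_sinh_iff.mpr (by positivity)
        rw [e1, Real.cosh_two_mul, Real.cosh_sq]
        nlinarith
      refine le_trans ?_ hc
      rw [← Real.le_log_iff_exp_le (by positivity)]
      refine le_trans ?_ (Real.one_sub_inv_le_log_of_pos (by positivity))
      rw [le_sub_iff_add_le, ← le_sub_iff_add_le', inv_le_iff_one_le_mul₀ (by positivity)]
      have : 0 ≤ (β^2/2)^3 := by positivity
      nlinarith
    calc Real.exp (T/2 - T * η^2/8) ≤ Real.exp (N * (β^2/2 * (1 - β^2/2))) := by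
          apply Real.exp_le_exp.mpr
          have : N * (β^2/2 * (1 - β^2/2)) = T/2 - T * (β^2/4) := by rw [hT]; ring
          rw [this]
          have := mul_le_mul_of_nonneg_left hβ2 hTpos.le
          linarith
      _ = Real.exp (β^2/2 * (1 - β^2/2)) ^ (Fintype.card ι) := by rw [hNdef, Real.exp_nat_mul]
      _ ≤ _ := pow_le_pow_left₀ (Real.exp_pos _).le h1 _
  have hexp1 : Real.exp (-(3/2:ℝ)) ≤ 1/4 := by
    have h1 : Real.exp (-(3/2:ℝ)) = (Real.exp 3)⁻¹ ^ (1/2:ℝ) := by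
      rw [← Real.exp_neg, ← Real.exp_mul]; norm_num
    have h2 : (Real.exp (-(3/2:ℝ)))^2 ≤ (1/4)^2 := by
      rw [← Real.exp_nat_mul]
      have h3 : Real.exp ((2:ℕ) * -(3/2:ℝ)) = (Real.exp 1 ^ 3)⁻¹ := by
        rw [← Real.exp_nat_mul, ← Real.exp_neg]; norm_num
      rw [h3, inv_le_comm₀ (by positivity) (by norm_num)]
      have := Real.exp_one_gt_d9
      have h4 : (2.7:ℝ)^3 ≤ Real.exp 1 ^ 3 := pow_le_pow_left₀ (by norm_num) (by linarith) 3
      norm_num at h4 ⊢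
      linarith
    exact le_of_sq_le_sq h2 (by norm_num)
  have hD : Real.exp (T/2 - η^2*T/2) ≤ 1/4 * Real.exp (T/2 - T*η^2/8) := by
    have : Real.exp (T/2 - η^2*T/2) = Real.exp (-(3/8 * (T * η^2))) * Real.exp (T/2 - T*η^2/8) := by
      rw [← Real.exp_add]; congr 1; ring
    rw [this]
    gcongr
    refine le_trans (Real.exp_le_exp.mpr ?_) hexp1
    linarith
  calc Real.exp (-(T * (1/2 + 2*η)))
      ≤ Real.exp (-(T * (1+η))) * (1/2 * Real.exp (T/2 - T*η^2/8)) := by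
        have e2 : (1/4:ℝ) * Real.exp (T/2 - T*η^2/8) ≤ 1/2 * Real.exp (T/2 - T*η^2/8) := by
          have := Real.exp_pos (T/2 - T*η^2/8)
          linarith
        refine le_trans ?_ (mul_le_mul_of_nonneg_left e2 (Real.exp_pos _).le)
        refine le_trans ?_ (mul_le_mul_of_nonneg_left (mul_le_mul_of_nonneg_right hexp1 (Real.exp_pos _).le) (Real.exp_pos _).le)
        rw [← Real.exp_add, ← Real.exp_add]
        apply Real.exp_le_exp.mpr
        have : η^2 ≤ η := by nlinarith
        have := mul_le_mul_of_nonneg_left this hTpos.le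
        nlinarith
    _ ≤ _ := by
        gcongr
        linarith

lemma pair_upper (g h : ι → ZMod 2) (β η ε T : ℝ) (hβ : 0 < β) (hη : 0 < η) (hη1 : η ≤ 1) (hε : 0 < ε)
    (hT : T = Fintype.card ι * β^2) (hgh : Yc g h ≤ ε * Fintype.card ι) (hε1 : ε ≤ 1) :
    Pr (fun f => (1-η) * β * Fintype.card ι ≤ Yc f g ∧ (1-η) * β * Fintype.card ι ≤ Yc f h)
      ≤ Real.exp (-(T * (1 - 2*η - ε))) := by
  set N : ℝ := (Fintype.card ι : ℝ) with hNdef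
  have hTn : 0 ≤ T := by rw [hT]; positivity
  have hpos : 0 ≤ (1-η)*β := mul_nonneg (by linarith) hβ.le
  · refine (markov _ (fun f => (1-η)*β * (Yc f g + Yc f h)) (2 * ((1-η)*β)^2 * N) ?_).trans ?_
    · rintro f ⟨h1, h2⟩
      have h1 := mul_le_mul_of_nonneg_left h1 hpos
      have h2 := mul_le_mul_of_nonneg_left h2 hpos
      nlinarith
    · refine (mul_le_mul_of_nonneg_left (Ex_mgf_pair _ g h) (Real.exp_pos _).le).trans ?_
      rw [← Real.exp_add]
      apply Real.exp_le_exp.mpr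
      rw [← hNdef]
      have := mul_le_mul_of_nonneg_left hgh (sq_nonneg ((1-η)*β))
      have e1 : ((1-η)*β)^2 * N = (1-η)^2 * T := by rw [hT]; ring
      have e2 : (1 - 2*η - ε) ≤ (1-η)^2 * (1-ε) := by
        nlinarith [mul_nonneg (sq_nonneg η) (sub_nonneg.mpr hε1), mul_pos hη hε]
      have e3 := mul_le_mul_of_nonneg_left e2 hTn
      nlinarith

/-- Second moment lower bound for the maximum, combined with concentration. -/
lemma lower_max (G : Finset (ι → ZMod 2)) (hG : G.Nonempty) (β η T B : ℝ) (hβ : 0 < β)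
    (hη : 0 < η) (hη1 : η ≤ 1) (hT : T = Fintype.card ι * β^2) (hβ2 : β^2 ≤ η^2/2)
    (hT4 : 4 ≤ T * η^2) (hN : 0 < Fintype.card ι)
    (hcard : Real.exp (T/2) ≤ G.card)
    (hB : ∀ g ∈ G, ((G.filter (fun h => η * Fintype.card ι < Yc g h)).card : ℝ) ≤ B)
    (hBT : B ≤ Real.exp (T * η)) :
    β * Fintype.card ι * (1 - η - 4 * Real.sqrt η) ≤ Ex (Mx G hG) := by
  classical
  set N : ℝ := (Fintype.card ι : ℝ) with hNdef
  have hN' : 0 < N := by rw [hNdef]; exact_mod_cast hN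
  have hTpos : 0 < T := by rw [hT]; positivity
  set lam : ℝ := (1-η) * β * N with hlam
  set ind : (ι → ZMod 2) → (ι → ZMod 2) → ℝ := fun g f => if lam ≤ Yc f g then 1 else 0 with hind
  set W : (ι → ZMod 2) → ℝ := fun f => ∑ g ∈ G, ind g f with hW
  set P : ℝ := Pr (fun f => lam ≤ Mx G hG f) with hP
  set p : (ι → ZMod 2) → ℝ := fun g => Pr (fun f => lam ≤ Yc f g) with hp
  set S : ℝ := ∑ g ∈ G, p g with hS
  have hind01 : ∀ g f, ind g f = 0 ∨ ind g f = 1 := by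
    intro g f
    simp only [hind]
    split_ifs <;> simp
  have hEW : Ex W = S := by
    rw [hW, Ex_sum]
    apply Finset.sum_congr rfl
    intro g _
    simp only [hp, Pr, hind]
  have hpl : ∀ g, Real.exp (-(T * (1/2 + 2*η))) ≤ p g := by
    intro g
    exact tail_lower g β η T hβ hη hη1 hT hβ2 hT4
  have hSl : (G.card : ℝ) * Real.exp (-(T * (1/2 + 2*η))) ≤ S := by
    rw [hS, ← nsmul_eq_mul]
    exact Finset.card_nsmul_le_sum _ _ _ (fun g _ => hpl g)
  have hcpos : (0:ℝ) < G.card := by exact_mod_cast hG.card_pos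
  have hSpos : 0 < S := lt_of_lt_of_le (by positivity) hSl
  -- second moment
  have hpair : ∀ g h, Ex (fun f => ind g f * ind h f) = Pr (fun f => lam ≤ Yc f g ∧ lam ≤ Yc f h) := by
    intro g h
    simp only [Pr, hind]
    congr 1
    ext f
    by_cases h1 : lam ≤ Yc f g <;> by_cases h2 : lam ≤ Yc f h <;> simp [h1, h2]
  have hEW2 : Ex (fun f => W f ^ 2) ≤
      (G.card:ℝ)^2 * Real.exp (-(T * (1 - 3*η))) + B * S := by
    have e1 : (fun f => W f ^ 2) = fun f => ∑ g ∈ G, ∑ h ∈ G, ind g f * ind h f := by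
      ext f
      rw [sq, hW, Finset.sum_mul_sum]
    rw [e1, Ex_sum]
    have e2 : ∀ g ∈ G, Ex (fun f => ∑ h ∈ G, ind g f * ind h f) ≤
        (G.card:ℝ) * Real.exp (-(T * (1 - 3*η))) + B * p g := by
      intro g hg
      rw [Ex_sum]
      have e3 : ∀ h ∈ G, Ex (fun f => ind g f * ind h f) ≤
          Real.exp (-(T * (1 - 3*η))) + (if η * N < Yc g h then p g else 0) := by
        intro h _
        rw [hpair]
        by_cases hb : η * N < Yc g h
        · rw [if_pos hb]
          have : Pr (fun f => lam ≤ Yc f g ∧ lam ≤ Yc f h) ≤ p g := Pr_mono (fun f hf => hf.1)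
          linarith [Real.exp_pos (-(T * (1 - 3*η)))]
        · rw [if_neg hb, add_zero]
          have := pair_upper g h β η η T hβ hη hη1 hη hT (not_lt.mp hb) hη1
          refine this.trans (Real.exp_le_exp.mpr ?_)
          linarith
      refine (Finset.sum_le_sum e3).trans ?_
      rw [Finset.sum_add_distrib, Finset.sum_const, nsmul_eq_mul, ← Finset.sum_filter,
        Finset.sum_const, nsmul_eq_mul]
      have : 0 ≤ p g := Pr_nonneg _
      have := mul_le_mul_of_nonneg_right (hB g hg) this
      linarith
    refine (Finset.sum_le_sum e2).trans ?_
    rw [Finset.sum_add_distrib, Finset.sum_const, nsmul_eq_mul, ← Finset.mul_sum]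
    apply le_of_eq; ring
  -- Cauchy-Schwarz
  have hCS : S ^ 2 ≤ P * Ex (fun f => W f ^ 2) := by
    have hWz : ∀ f, W f = (if lam ≤ Mx G hG f then 1 else 0) * W f := by
      intro f
      split_ifs with h
      · simp
      · rw [zero_mul, hW]
        apply Finset.sum_eq_zero
        intro g hg
        simp only [hind]
        rw [if_neg]
        intro h2
        exact h (h2.trans (Finset.le_sup' (fun g => Yc f g) hg))
    rw [← hEW, hP]
    unfold Pr Ex
    rw [div_pow, div_mul_div_comm, ← sq]
    gcongr
    have := Finset.sum_mul_sq_le_sq_mul_sq Finset.univ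
      (fun f => if lam ≤ Mx G hG f then (1:ℝ) else 0) W
    simp_rw [← hWz] at this
    refine this.trans (le_of_eq ?_)
    congr 1
    apply Finset.sum_congr rfl
    intro f _
    by_cases hq : lam ≤ Mx G hG f <;> simp [hq]
  have hPl : Real.exp (-(T * (8*η))) ≤ P := by
    have hPnn : 0 ≤ P := Pr_nonneg _
    -- both terms
    have t1 : (G.card:ℝ)^2 * Real.exp (-(T * (1 - 3*η))) ≤ Real.exp (T * (7*η)) * S^2 := by
      calc (G.card:ℝ)^2 * Real.exp (-(T * (1 - 3*η)))
          = Real.exp (T * (7*η)) * ((G.card : ℝ) * Real.exp (-(T * (1/2 + 2*η))))^2 := by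
            rw [mul_pow, ← Real.exp_nat_mul, mul_left_comm, ← Real.exp_add]
            congr 2
            push_cast
            ring
        _ ≤ _ := by gcongr
    have t2 : B * S ≤ Real.exp (T * (7*η)) * S^2 := by
      have : B ≤ Real.exp (T * (7*η)) * S := by
        calc B ≤ Real.exp (T * η) := hBT
          _ ≤ Real.exp (T * (7*η)) * (Real.exp (T/2) * Real.exp (-(T * (1/2 + 2*η)))) := by
            rw [← Real.exp_add, ← Real.exp_add]
            apply Real.exp_le_exp.mpr
            nlinarith [mul_pos hTpos hη]
          _ ≤ Real.exp (T * (7*η)) * (G.card * Real.exp (-(T * (1/2 + 2*η)))) := by gcongr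
          _ ≤ _ := by gcongr
      nlinarith
    have t3 : S^2 ≤ P * (2 * Real.exp (T * (7*η)) * S^2) := by
      refine hCS.trans ?_
      apply mul_le_mul_of_nonneg_left _ hPnn
      linarith
    have t4 : 1 ≤ P * (2 * Real.exp (T * (7*η))) := by
      have : 1 * S^2 ≤ (P * (2 * Real.exp (T * (7*η)))) * S^2 := by linarith
      exact le_of_mul_le_mul_right this (by positivity)
    have t5 : 2 ≤ Real.exp (T * η) := by
      have h1 : 1 ≤ T * η := by
        have : η^2 ≤ η := by nlinarith
        have := mul_le_mul_of_nonneg_left this hTpos.le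
        linarith
      have := Real.add_one_le_exp (T * η)
      linarith
    have t6 : 2 * Real.exp (T * (7*η)) ≤ Real.exp (T * (8*η)) := by
      have : Real.exp (T * (8*η)) = Real.exp (T*η) * Real.exp (T * (7*η)) := by
        rw [← Real.exp_add]; congr 1; ring
      rw [this]; gcongr
    have t7 : 1 ≤ P * Real.exp (T * (8*η)) := t4.trans (by gcongr)
    rw [Real.exp_neg]
    rwa [inv_le_iff_one_le_mul₀ (Real.exp_pos _)]
  -- conclude
  by_cases hu : lam ≤ Ex (Mx G hG)
  · refine le_trans ?_ hu
    rw [hlam]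
    have : 0 ≤ β * N * (4 * Real.sqrt η) := by positivity
    linarith
  · push Not at hu
    have hc := conc G hG (lam - Ex (Mx G hG)) (by linarith) hN
    have e : (fun f => Ex (Mx G hG) + (lam - Ex (Mx G hG)) ≤ Mx G hG f) =
        fun f => lam ≤ Mx G hG f := by
      ext f; rw [add_sub_cancel]
    rw [e] at hc
    have h3 := Real.exp_le_exp.mp (hPl.trans hc)
    set u := lam - Ex (Mx G hG) with hu'
    have h4 : u^2 ≤ (β * N * (4 * Real.sqrt η))^2 := by
      have h5 : u^2 / (2*N) ≤ T * (8*η) := by linarith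
      rw [div_le_iff₀ (by positivity)] at h5
      rw [mul_pow, mul_pow, mul_pow, Real.sq_sqrt hη.le]
      rw [hT] at h5
      linarith
    have h6 := abs_le_of_sq_le_sq' h4 (by positivity)
    have h7 := h6.2
    rw [hlam] at hu'
    linarith

end generic

/-- Multilinear monomial function. -/
def mono {n : ℕ} (J : Finset (Fin n)) : BF n := fun x => ∏ j ∈ J, x j

/-- The span of monomials of degree at most `s`. -/
def RMs (s n : ℕ) : Submodule (ZMod 2) (BF n) :=
  Submodule.span (ZMod 2) (Set.range (fun J : {J : Finset (Fin n) // J.card ≤ s} => mono J.1))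

lemma mono_mem {s n : ℕ} (J : Finset (Fin n)) (h : J.card ≤ s) : mono J ∈ RMs s n :=
  Submodule.subset_span ⟨⟨J, h⟩, rfl⟩

lemma zmod2_pow (z : ZMod 2) (k : ℕ) (hk : k ≠ 0) : z ^ k = z := by
  rcases zmod2_cases z with rfl | rfl
  · simp [hk]
  · simp

lemma RM_eq (s n : ℕ) : RM s n = (RMs s n : Set (BF n)) := by
  ext g
  constructor
  · rintro ⟨p, hp, hg⟩
    have : g = ∑ m ∈ p.support, (p.coeff m) • mono m.support := by
      ext x
      rw [← hg x, MvPolynomial.eval_eq, Finset.sum_apply]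
      apply Finset.sum_congr rfl
      intro m _
      simp only [Pi.smul_apply, smul_eq_mul, mono]
      congr 1
      apply Finset.prod_congr rfl
      intro i hi
      exact zmod2_pow _ _ (Finsupp.mem_support_iff.mp hi)
    rw [this]
    apply Submodule.sum_mem
    intro m hm
    apply Submodule.smul_mem
    apply mono_mem
    have h1 := MvPolynomial.le_totalDegree hm
    refine le_trans ?_ (h1.trans hp)
    rw [Finsupp.sum, Finset.card_eq_sum_ones]
    apply Finset.sum_le_sum
    intro i hi
    exact Nat.one_le_iff_ne_zero.mpr (Finsupp.mem_support_iff.mp hi)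
  · intro hg
    induction hg using Submodule.span_induction with
    | mem x hx =>
      obtain ⟨⟨J, hJ⟩, rfl⟩ := hx
      refine ⟨∏ j ∈ J, MvPolynomial.X j, ?_, ?_⟩
      · refine (MvPolynomial.totalDegree_finsetProd _ _).trans ?_
        simpa using hJ
      · intro x
        simp [mono]
    | zero => exact ⟨0, by simp, by simp⟩
    | add x y _ _ hx hy =>
      obtain ⟨p, hp, hp'⟩ := hx
      obtain ⟨q, hq, hq'⟩ := hy
      refine ⟨p + q, (MvPolynomial.totalDegree_add _ _).trans (max_le hp hq), ?_⟩
      intro z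
      simp [hp', hq']
    | smul a x _ hx =>
      obtain ⟨p, hp, hp'⟩ := hx
      refine ⟨a • p, (MvPolynomial.totalDegree_smul_le _ _).trans hp, ?_⟩
      intro z
      simp [hp', MvPolynomial.smul_eval]

/-- The number of monomials of degree at most `s`. -/
def Dm (s n : ℕ) : ℕ := ∑ i ∈ Finset.range (s+1), n.choose i

lemma card_low (s n : ℕ) : Fintype.card {J : Finset (Fin n) // J.card ≤ s} = Dm s n := by
  rw [Fintype.card_subtype]
  have : (Finset.univ.filter (fun J : Finset (Fin n) => J.card ≤ s)) =
      (Finset.range (s+1)).biUnion (fun i => Finset.powersetCard i Finset.univ) := by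
    ext J
    simp [Finset.mem_powersetCard]
  rw [this, Finset.card_biUnion]
  · simp [Dm]
  · intro i _ j _ hij
    exact Finset.pairwise_disjoint_powersetCard _ hij

lemma card_RMs_le (s n : ℕ) : Nat.card (RMs s n) ≤ 2 ^ (Dm s n) := by
  have : Fintype (RMs s n) := Fintype.ofFinite _
  have h1 : Nat.card (RMs s n) = 2 ^ (Module.finrank (ZMod 2) (RMs s n)) := by
    rw [Nat.card_eq_fintype_card, Module.card_eq_pow_finrank (K := ZMod 2), ZMod.card]
  rw [h1]
  apply Nat.pow_le_pow_right (by norm_num)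
  rw [← card_low]
  exact finrank_range_le_card _

lemma le_card_RMs (s n : ℕ) : 2 ^ (n.choose s) ≤ Nat.card (RMs s n) := by
  have : Fintype (RMs s n) := Fintype.ofFinite _
  have h1 : Fintype.card ({J : Finset (Fin n) // J.card = s} → ZMod 2) = 2 ^ (n.choose s) := by
    rw [Fintype.card_fun, ZMod.card]
    congr 1
    rw [Fintype.card_finset_len, Fintype.card_fin]
  rw [← h1, Nat.card_eq_fintype_card]
  let Φ : ({J : Finset (Fin n) // J.card = s} → ZMod 2) → RMs s n := fun c =>
    ⟨∑ J, c J • mono J.1, Submodule.sum_mem _ (fun J _ => Submodule.smul_mem _ _ (mono_mem _ J.2.le))⟩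
  apply Fintype.card_le_of_injective Φ
  intro c d hcd
  have hev : ∀ (c : {J : Finset (Fin n) // J.card = s} → ZMod 2) (K : {J : Finset (Fin n) // J.card = s}),
      (Φ c).1 (fun i => if i ∈ K.1 then 1 else 0) = c K := by
    intro c K
    simp only [Φ, Finset.sum_apply, Pi.smul_apply, smul_eq_mul, mono]
    rw [Finset.sum_eq_single K]
    · rw [Finset.prod_eq_one, mul_one]
      intro i hi
      rw [if_pos hi]
    · intro J _ hJ
      have : ∃ i ∈ J.1, i ∉ K.1 := by
        by_contra hcon
        push Not at hcon
        apply hJ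
        apply Subtype.ext
        exact Finset.eq_of_subset_of_card_le hcon (by rw [J.2, K.2])
      obtain ⟨i, hi, hi'⟩ := this
      rw [Finset.prod_eq_zero hi (by rw [if_neg hi']), mul_zero]
    · simp
  ext K
  rw [← hev c K, ← hev d K, hcd]

/-- Discrete derivative. -/
def Dv {n : ℕ} (a : Fin n → ZMod 2) (h : BF n) : BF n := fun x => h (x + a) + h x

lemma zmod2_add_self (z : ZMod 2) : z + z = 0 := by
  revert z; decide

lemma Dv_mem {s n : ℕ} (a : Fin n → ZMod 2) (h : BF n) (hh : h ∈ RMs (s+1) n) :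
    Dv a h ∈ RMs s n := by
  induction hh using Submodule.span_induction with
  | mem x hx =>
    obtain ⟨⟨J, hJ⟩, rfl⟩ := hx
    have : Dv a (mono J) = ∑ K ∈ J.powerset.erase J, (∏ i ∈ J \ K, a i) • mono K := by
      ext x
      simp only [Dv, mono, Pi.add_apply, Finset.sum_apply, Pi.smul_apply, smul_eq_mul]
      rw [Finset.prod_add, ← Finset.add_sum_erase _ _ (Finset.mem_powerset_self J)]
      simp only [Finset.sdiff_self, Finset.prod_empty, mul_one]
      rw [add_comm, ← add_assoc, zmod2_add_self, zero_add]
      apply Finset.sum_congr rfl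
      intro K _
      ring
    rw [this]
    apply Submodule.sum_mem
    intro K hK
    apply Submodule.smul_mem
    apply mono_mem
    rw [Finset.mem_erase, Finset.mem_powerset] at hK
    have := Finset.card_lt_card (Finset.ssubset_iff_subset_ne.mpr ⟨hK.2, hK.1⟩)
    omega
  | zero =>
    have : Dv a (0 : BF n) = 0 := by ext x; simp [Dv]
    rw [this]; exact Submodule.zero_mem _
  | add x y _ _ hx hy =>
    have : Dv a (x + y) = Dv a x + Dv a y := by ext z; simp [Dv]; ring
    rw [this]; exact Submodule.add_mem _ hx hy
  | smul c x _ hx =>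
    have : Dv a (c • x) = c • Dv a x := by ext z; simp [Dv]; ring
    rw [this]; exact Submodule.smul_mem _ _ hx

/-- Support size. -/
def sw {n : ℕ} (g : BF n) : ℕ := (Finset.univ.filter (fun x => g x ≠ 0)).card

lemma min_dist (s n : ℕ) : ∀ g ∈ RMs s n, g ≠ 0 → 2 ^ n ≤ 2 ^ s * sw g := by
  have hconst : ∀ g : BF n, g ≠ 0 → (∀ a, Dv a g = 0) → sw g = 2 ^ n := by
    intro g hg h
    obtain ⟨x0, hx0⟩ := Function.ne_iff.mp hg
    have : ∀ x, g x ≠ 0 := by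
      intro x
      have h1 := congrFun (h (x0 - x)) x
      simp only [Dv, Pi.zero_apply, add_sub_cancel] at h1
      intro h2
      rw [h2, add_zero] at h1
      exact hx0 h1
    unfold sw
    rw [Finset.filter_true_of_mem (fun x _ => this x)]
    simp [ZMod.card]
  induction s with
  | zero =>
    intro g hg hne
    rw [hconst g hne]
    · simp
    · intro a
      induction hg using Submodule.span_induction with
      | mem x hx =>
        obtain ⟨⟨J, hJ⟩, rfl⟩ := hx
        have : J = ∅ := by simpa using hJ
        subst this
        ext x
        simp [Dv, mono, zmod2_add_self]
      | zero => ext x; simp [Dv]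
      | add x y _ _ hx hy =>
        have : Dv a (x + y) = Dv a x + Dv a y := by ext z; simp [Dv]; ring
        by_cases hx0 : x = 0
        · subst hx0
          rw [zero_add] at hne ⊢
          exact hy hne
        · by_cases hy0 : y = 0
          · subst hy0
            rw [add_zero] at hne ⊢
            exact hx hne
          · rw [this, hx hx0, hy hy0, add_zero]
      | smul c x _ hx =>
        have : Dv a (c • x) = c • Dv a x := by ext z; simp [Dv]; ring
        rw [this, hx (by rintro rfl; simp at hne), smul_zero]
  | succ s ih =>
    intro g hg hne
    by_cases h : ∀ a, Dv a g = 0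
    · rw [hconst g hne h]
      exact Nat.le_mul_of_pos_left _ (by positivity)
    · push Not at h
      obtain ⟨a, ha⟩ := h
      have h1 := ih (Dv a g) (Dv_mem a g hg) ha
      have h2 : sw (Dv a g) ≤ sw g + sw g := by
        have hsub : (Finset.univ.filter (fun x => Dv a g x ≠ 0)) ⊆
            (Finset.univ.filter (fun x => g x ≠ 0)).image (fun x => x - a) ∪
              (Finset.univ.filter (fun x => g x ≠ 0)) := by
          intro x hx
          have hx' : g (x + a) + g x ≠ 0 := (Finset.mem_filter.mp hx).2
          simp only [Finset.mem_filter, Finset.mem_univ, true_and, Finset.mem_union,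
            Finset.mem_image]
          by_cases hgx : g x = 0
          · left
            refine ⟨x + a, ?_, by simp⟩
            rwa [hgx, add_zero] at hx'
          · right; exact hgx
        unfold sw
        refine (Finset.card_le_card hsub).trans ((Finset.card_union_le _ _).trans ?_)
        exact Nat.add_le_add_right Finset.card_image_le _
      calc 2 ^ n ≤ 2 ^ s * sw (Dv a g) := h1
        _ ≤ 2 ^ s * (sw g + sw g) := by gcongr
        _ = _ := by ring

/-- Majority decoding. -/
def dec {n t : ℕ} (u : Fin t → BF n) : BF n := fun x => if 0 < ∑ i, sg (u i x) then 0 else 1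

lemma exp_sg (ε : ℝ) (z : ZMod 2) : Real.exp (-(ε * sg z)) = Real.cosh ε - sg z * Real.sinh ε := by
  rw [Real.cosh_eq, Real.sinh_eq]
  rcases sg_cases z with h | h <;> rw [h] <;> ring_nf

lemma exists_dirs (n t : ℕ) (h : BF n) (ε : ℝ) (hε : 0 < ε) (hε1 : ε ≤ 1)
    (hb : ε * 2^n ≤ ∑ x, sg (h x)) :
    ∃ a : Fin t → (Fin n → ZMod 2),
      ((Finset.univ.filter (fun x => dec (fun i => Dv (a i) h) x ≠ h x)).card : ℝ)
        ≤ 2^n * (1 - ε^2/4)^t := by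
  set V := (Fin n → ZMod 2) with hV
  set c : ℝ := 2^n * (1 - ε^2/4)^t with hc
  have hQ : ∀ x : V, ∑ v : V, Real.exp (-(ε * sg (h (x + v)))) ≤ 2^n * (1 - ε^2/4) := by
    intro x
    have e1 : ∑ v : V, Real.exp (-(ε * sg (h (x + v)))) = ∑ v : V, Real.exp (-(ε * sg (h v))) :=
      Equiv.sum_comp (Equiv.addLeft x) (fun v => Real.exp (-(ε * sg (h v))))
    rw [e1]
    simp_rw [exp_sg]
    rw [Finset.sum_sub_distrib, ← Finset.sum_mul]
    have e2 : ∑ _v : V, Real.cosh ε = 2^n * Real.cosh ε := by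
      simp [hV, ZMod.card]
    rw [e2]
    have hs : ε ≤ Real.sinh ε := Real.self_le_sinh_iff.mpr hε.le
    have h1 : ε * 2^n * ε ≤ (∑ x, sg (h x)) * Real.sinh ε := by
      apply mul_le_mul hb hs hε.le
      exact le_trans (by positivity) hb
    have h2 : Real.cosh ε ≤ 1 + 3/4 * ε^2 := by
      refine (Real.cosh_le_exp_half_sq ε).trans ?_
      have h3 : |ε^2/2| ≤ 1 := by
        rw [abs_of_nonneg (by positivity)]; nlinarith
      have h4 := (abs_le.mp (Real.abs_exp_sub_one_sub_id_le h3)).2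
      have h7 : ε^2 ≤ 1 := by nlinarith
      have h8 := mul_le_mul_of_nonneg_left h7 (sq_nonneg ε)
      nlinarith
    have h5 : (0:ℝ) < 2^n := by positivity
    have h6 := mul_le_mul_of_nonneg_left h2 h5.le
    linarith
  have hsum : ∑ a : Fin t → V,
      ((Finset.univ.filter (fun x => dec (fun i => Dv (a i) h) x ≠ h x)).card : ℝ)
      ≤ ∑ _a : Fin t → V, c := by
    have e1 : ∀ a : Fin t → V,
        ((Finset.univ.filter (fun x => dec (fun i => Dv (a i) h) x ≠ h x)).card : ℝ)
          ≤ ∑ x : V, ∏ i, Real.exp (-(ε * sg (h (x + a i)))) := by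
      intro a
      rw [Finset.card_filter]
      push_cast
      apply Finset.sum_le_sum
      intro x _
      split_ifs with hx
      · rw [← Real.exp_sum]
        apply Real.one_le_exp
        rw [Finset.sum_neg_distrib, ← Finset.mul_sum]
        by_contra hneg
        push Not at hneg
        have hpos : 0 < ∑ i, sg (h (x + a i)) := by
          by_contra hcon
          push Not at hcon
          have := mul_nonneg_of_nonpos_of_nonpos (neg_nonpos.mpr hε.le) hcon
          linarith
        apply hx
        unfold dec Dv
        simp_rw [sg_add, ← Finset.sum_mul]
        rcases zmod2_cases (h x) with h0 | h0
        · rw [h0, sg_zero, mul_one, if_pos hpos]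
        · rw [h0, sg_one, if_neg]
          linarith
      · exact Finset.prod_nonneg (fun i _ => (Real.exp_pos _).le)
    refine (Finset.sum_le_sum (fun a _ => e1 a)).trans ?_
    rw [Finset.sum_comm]
    have e2 : ∀ x : V, ∑ a : Fin t → V, ∏ i, Real.exp (-(ε * sg (h (x + a i))))
        = (∑ v : V, Real.exp (-(ε * sg (h (x + v))))) ^ t := by
      intro x
      have := Finset.prod_univ_sum (fun _ : Fin t => (Finset.univ : Finset V))
        (fun _ v => Real.exp (-(ε * sg (h (x + v)))))
      rw [Fintype.piFinset_univ] at this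
      rw [← this]
      simp
    simp_rw [e2]
    have e3 : ∀ x : V, (∑ v : V, Real.exp (-(ε * sg (h (x + v))))) ^ t ≤ (2^n * (1 - ε^2/4))^t := by
      intro x
      exact pow_le_pow_left₀ (Finset.sum_nonneg (fun _ _ => (Real.exp_pos _).le)) (hQ x) t
    refine (Finset.sum_le_sum (fun x _ => e3 x)).trans (le_of_eq ?_)
    simp only [Finset.sum_const, Finset.card_univ, nsmul_eq_mul, hc, hV, Fintype.card_fun, ZMod.card,
      Fintype.card_fin]
    push_cast
    rw [mul_pow]
    ring
  obtain ⟨a, _, ha⟩ := Finset.exists_le_of_sum_le Finset.univ_nonempty hsum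
  exact ⟨a, ha⟩

open Classical in
/-- The Reed-Muller code as a finset. -/
def Gf (s n : ℕ) : Finset (BF n) := Finset.univ.filter (fun g => g ∈ RMs s n)

lemma mem_Gf {s n : ℕ} (g : BF n) : g ∈ Gf s n ↔ g ∈ RMs s n := by
  simp [Gf]

lemma card_Gf (s n : ℕ) : (Gf s n).card = Nat.card (RMs s n) :=
  (Nat.subtype_card (Gf s n) (fun x => mem_Gf x)).symm

lemma biased_count (s : ℕ) (ε : ℝ) (hε : 0 < ε) (hε1 : ε ≤ 1) :
    ∃ t : ℕ, ∀ n : ℕ,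
      ((Gf (s+1) n).filter (fun h => ε * 2^n < ∑ x, sg (h x))).card ≤ (2 ^ (Dm s n)) ^ t := by
  classical
  have hq0 : 0 ≤ 1 - ε^2/4 := by nlinarith
  have hq1 : 1 - ε^2/4 < 1 := by nlinarith
  obtain ⟨t, ht⟩ := exists_pow_lt_of_lt_one (show (0:ℝ) < 1/2^(s+2) by positivity) hq1
  refine ⟨t, fun n => ?_⟩
  set S := (Gf (s+1) n).filter (fun h => ε * 2^n < ∑ x, sg (h x)) with hS
  have hex : ∀ h : BF n, ∃ a : Fin t → (Fin n → ZMod 2), h ∈ S →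
      ((Finset.univ.filter (fun x => dec (fun i => Dv (a i) h) x ≠ h x)).card : ℝ)
        < 2^n / 2^(s+2) := by
    intro h
    by_cases hh : h ∈ S
    · obtain ⟨a, ha⟩ := exists_dirs n t h ε hε hε1 (Finset.mem_filter.mp hh).2.le
      refine ⟨a, fun _ => lt_of_le_of_lt ha ?_⟩
      have := mul_lt_mul_of_pos_left ht (show (0:ℝ) < 2^n by positivity)
      rwa [mul_one_div] at this
    · exact ⟨fun _ => 0, fun h' => absurd h' hh⟩
  choose a ha using hex
  have hle : S.card ≤ (Fintype.piFinset (fun _ : Fin t => Gf s n)).card := by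
    apply Finset.card_le_card_of_injOn (fun h i => Dv (a h i) h)
    · intro h hh
      simp only [Finset.mem_coe, Fintype.mem_piFinset]
      intro i
      rw [mem_Gf]
      apply Dv_mem
      rw [← mem_Gf]
      exact (Finset.mem_filter.mp hh).1
    · intro h hh k hk heq
      have h1 := ha h hh
      have h2 := ha k hk
      have heq' : (fun i => Dv (a h i) h) = (fun i => Dv (a k i) k) := heq
      rw [← heq'] at h2
      set u := dec (fun i => Dv (a h i) h) with hu
      by_contra hne
      have hsub : h - k ∈ RMs (s+1) n :=
        Submodule.sub_mem _ ((mem_Gf _).mp (Finset.mem_filter.mp hh).1)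
          ((mem_Gf _).mp (Finset.mem_filter.mp hk).1)
      have hd := min_dist (s+1) n (h - k) hsub (sub_ne_zero.mpr hne)
      have hw : sw (h - k) ≤ (Finset.univ.filter (fun x => u x ≠ h x)).card +
          (Finset.univ.filter (fun x => u x ≠ k x)).card := by
        unfold sw
        refine le_trans (Finset.card_le_card ?_) (Finset.card_union_le _ _)
        intro x hx
        have hx' : h x - k x ≠ 0 := (Finset.mem_filter.mp hx).2
        simp only [Finset.mem_union, Finset.mem_filter, Finset.mem_univ, true_and]
        by_contra hcon
        push Not at hcon
        apply hx'
        rw [← hcon.1, ← hcon.2, sub_self]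
      have hd' : (2:ℝ)^n ≤ 2^(s+1) * sw (h - k) := by exact_mod_cast hd
      have hw' : (sw (h - k) : ℝ) ≤ (Finset.univ.filter (fun x => u x ≠ h x)).card +
          (Finset.univ.filter (fun x => u x ≠ k x)).card := by exact_mod_cast hw
      have h3 : (sw (h-k) : ℝ) < 2^n / 2^(s+2) + 2^n / 2^(s+2) := by linarith
      have h4 : (2:ℝ)^(s+1) * sw (h - k) < 2^(s+1) * (2^n / 2^(s+2) + 2^n / 2^(s+2)) := by
        gcongr
      have h5 : (2:ℝ)^(s+1) * (2^n / 2^(s+2) + 2^n / 2^(s+2)) = 2^n := by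
        rw [pow_succ 2 (s+1)]
        field_simp
        ring
      linarith
  refine hle.trans ?_
  rw [Fintype.card_piFinset]
  simp only [Finset.prod_const, Finset.card_univ, Fintype.card_fin]
  apply Nat.pow_le_pow_left
  rw [card_Gf]
  exact card_RMs_le s n

lemma Yc_hdist {n : ℕ} (f g : BF n) : Yc f g = 2^n - 2 * (hdist f g : ℝ) := by
  have h1 : (hdist f g : ℝ) = ∑ x, (if f x ≠ g x then (1:ℝ) else 0) := by
    unfold hdist
    rw [Nat.card_eq_fintype_card, Fintype.card_subtype, Finset.card_filter]
    push_cast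
    apply Finset.sum_congr rfl
    intro x _
    simp
  have h2 : (2:ℝ)^n = ∑ _x : Fin n → ZMod 2, (1:ℝ) := by
    simp [ZMod.card]
  rw [h1, h2, Finset.mul_sum, ← Finset.sum_sub_distrib]
  unfold Yc
  apply Finset.sum_congr rfl
  intro x _
  rw [sg_add]
  rcases zmod2_cases (f x) with h | h <;> rcases zmod2_cases (g x) with h' | h' <;> rw [h, h'] <;>
    norm_num [sg_zero, sg_one]

lemma Gf_nonempty (s n : ℕ) : (Gf s n).Nonempty := ⟨0, (mem_Gf _).mpr (Submodule.zero_mem _)⟩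

lemma nonlin_eq (s n : ℕ) (f : BF n) :
    (nonlin s f : ℝ) = (2^n - Mx (Gf s n) (Gf_nonempty s n) f) / 2 := by
  have hmem : ∀ g, g ∈ Gf s n ↔ g ∈ RM s n := by
    intro g
    rw [mem_Gf, RM_eq]; rfl
  have hne : (hdist f '' RM s n).Nonempty :=
    (Set.image_nonempty).mpr ⟨0, (hmem 0).mp ((mem_Gf _).mpr (Submodule.zero_mem _))⟩
  obtain ⟨g, hg, hgeq⟩ := Nat.sInf_mem hne
  apply le_antisymm
  · obtain ⟨k, hk, h⟩ := Finset.exists_mem_eq_sup' (Gf_nonempty s n) (fun g => Yc f g)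
    unfold Mx
    rw [h, Yc_hdist]
    have : nonlin s f ≤ hdist f k := Nat.sInf_le ⟨k, (hmem k).mp hk, rfl⟩
    have : (nonlin s f : ℝ) ≤ hdist f k := by exact_mod_cast this
    linarith
  · have h1 : Yc f g ≤ Mx (Gf s n) (Gf_nonempty s n) f :=
      Finset.le_sup' (fun g => Yc f g) ((hmem g).mpr hg)
    rw [Yc_hdist, hgeq] at h1
    unfold nonlin
    linarith

lemma Enonlin (s n : ℕ) :
    (∑ g : BF n, (nonlin s g : ℝ)) / 2^(2^n) = (2^n - Ex (Mx (Gf s n) (Gf_nonempty s n))) / 2 := by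
  have h0 : (∑ g : BF n, (nonlin s g : ℝ)) / 2^(2^n) = Ex (fun f : BF n => (nonlin s f : ℝ)) := by
    unfold Ex
    simp [ZMod.card]
  rw [h0]
  have h1 : (fun f : BF n => (nonlin s f : ℝ)) =
      fun f => (1/2) * (2^n - Mx (Gf s n) (Gf_nonempty s n) f) := by
    ext f; rw [nonlin_eq]; ring
  rw [h1, Ex_mul, Ex_sub, Ex_const]
  ring

lemma choose_ratio (i k : ℕ) (h : i < k) :
    Tendsto (fun n : ℕ => (n.choose i : ℝ) / (n.choose k : ℝ)) atTop (nhds 0) := by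
  have h1 := (isTheta_choose i).1
  have h2 := (isTheta_choose k).2
  have h3 : (fun n : ℕ => ((n:ℝ))^i) =o[atTop] (fun n : ℕ => ((n:ℝ))^k) :=
    (Asymptotics.isLittleO_pow_pow_atTop_of_lt h).comp_tendsto tendsto_natCast_atTop_atTop
  exact ((h1.trans_isLittleO h3).trans_isBigO h2).tendsto_div_nhds_zero

lemma Dm_ratio (s : ℕ) :
    Tendsto (fun n : ℕ => (Dm s n : ℝ) / (n.choose (s+1) : ℝ)) atTop (nhds 0) := by
  have : (fun n : ℕ => (Dm s n : ℝ) / (n.choose (s+1) : ℝ)) =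
      fun n : ℕ => ∑ i ∈ Finset.range (s+1), (n.choose i : ℝ) / (n.choose (s+1) : ℝ) := by
    ext n
    unfold Dm
    push_cast
    rw [Finset.sum_div]
  rw [this]
  have h := tendsto_finsetSum (Finset.range (s+1)) (fun i hi =>
    choose_ratio i (s+1) (Finset.mem_range.mp hi))
  simpa using h

lemma choose_div_pow (k : ℕ) :
    Tendsto (fun n : ℕ => (n.choose k : ℝ) / 2^n) atTop (nhds 0) := by
  have h1 := (isTheta_choose k).1
  have h3 : (fun n : ℕ => ((n:ℝ))^k) =o[atTop] (fun n : ℕ => (2:ℝ)^n) :=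
    isLittleO_pow_const_const_pow_of_one_lt k (by norm_num)
  exact (h1.trans_isLittleO h3).tendsto_div_nhds_zero

lemma choose_atTop (s : ℕ) :
    Tendsto (fun n : ℕ => (n.choose (s+1) : ℝ)) atTop atTop := by
  have h := choose_ratio 0 (s+1) (by omega)
  simp only [Nat.choose_zero_right, Nat.cast_one, one_div] at h
  have h2 : Tendsto (fun n : ℕ => ((n.choose (s+1) : ℝ))⁻¹) atTop (nhdsWithin 0 (Set.Ioi 0)) := by
    rw [tendsto_nhdsWithin_iff]
    refine ⟨h, ?_⟩
    filter_upwards [eventually_ge_atTop (s+1)] with n hn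
    have : 0 < n.choose (s+1) := Nat.choose_pos hn
    have : (0:ℝ) < n.choose (s+1) := by exact_mod_cast this
    exact inv_pos.mpr this
  have h3 := h2.inv_tendsto_nhdsGT_zero
  refine h3.congr (fun n => ?_)
  simp

lemma two_mul_sqrt (x : ℝ) : 2 * Real.sqrt x = Real.sqrt (4 * x) := by
  rw [Real.sqrt_mul (by norm_num), show (4:ℝ) = 2^2 by norm_num, Real.sqrt_sq (by norm_num)]

lemma ratio_upper (s n : ℕ) (hn : s + 1 ≤ n) :
    Ex (Mx (Gf (s+1) n) (Gf_nonempty (s+1) n)) / 2 / Real.sqrt (2^(n-1) * (n.choose (s+1)) * Real.log 2)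
      ≤ Real.sqrt (1 + (Dm s n : ℝ) / (n.choose (s+1) : ℝ)) := by
  have hl := Real.log_pos (show (1:ℝ) < 2 by norm_num)
  have hC : (0:ℝ) < n.choose (s+1) := by exact_mod_cast Nat.choose_pos hn
  have hD : (Dm (s+1) n : ℝ) = Dm s n + n.choose (s+1) := by
    unfold Dm
    rw [Finset.sum_range_succ _ (s+1)]
    push_cast; rfl
  have hDn : (0:ℝ) ≤ Dm s n := Nat.cast_nonneg _
  have h := massart' (Gf (s+1) n) (Gf_nonempty (s+1) n) (Dm (s+1) n * Real.log 2) (by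
      have h1 : ((Gf (s+1) n).card : ℝ) ≤ 2 ^ (Dm (s+1) n) := by
        rw [card_Gf]; exact_mod_cast card_RMs_le (s+1) n
      have h2 : (0:ℝ) < (Gf (s+1) n).card := by exact_mod_cast (Gf_nonempty (s+1) n).card_pos
      have := Real.log_le_log h2 h1
      rwa [Real.log_pow] at this) (by rw [hD]; positivity) Fintype.card_pos
  have hN : ((Fintype.card (Fin n → ZMod 2) : ℕ) : ℝ) = 2 * 2^(n-1) := by
    have : (2:ℝ) * 2^(n-1) = 2^n := by rw [← pow_succ']; congr 1; omega
    rw [this]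
    simp [ZMod.card]
  rw [hN, hD] at h
  rw [div_div, div_le_iff₀ (by positivity)]
  refine h.trans (le_of_eq ?_)
  rw [two_mul_sqrt, ← Real.sqrt_mul (by positivity)]
  congr 1
  field_simp
  ring

lemma ratio_lower (s : ℕ) (η : ℝ) (hη : 0 < η) (hη1 : η ≤ 1) :
    ∀ᶠ n : ℕ in atTop, 1 - η - 4 * Real.sqrt η ≤
    Ex (Mx (Gf (s+1) n) (Gf_nonempty (s+1) n)) / 2 /
      Real.sqrt (2^(n-1) * (n.choose (s+1)) * Real.log 2) := by
  have hl := Real.log_pos (show (1:ℝ) < 2 by norm_num)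
  obtain ⟨t, ht⟩ := biased_count s η hη hη1
  have ev1 : ∀ᶠ n : ℕ in atTop, (n.choose (s+1) : ℝ) / 2^n ≤ η^2/2 / (2 * Real.log 2) :=
    (choose_div_pow (s+1)).eventually_le_const (by positivity)
  have ev2 : ∀ᶠ n : ℕ in atTop, 4 / η^2 / (2 * Real.log 2) ≤ (n.choose (s+1) : ℝ) :=
    (choose_atTop s).eventually_ge_atTop _
  have ev3 : ∀ᶠ n : ℕ in atTop, (Dm s n : ℝ) / (n.choose (s+1) : ℝ) ≤ 2 * η / (t + 1) :=
    (Dm_ratio s).eventually_le_const (by positivity)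
  filter_upwards [ev1, ev2, ev3, eventually_ge_atTop (s+1)] with n h1 h2 h3 hn
  set C : ℝ := (n.choose (s+1) : ℝ) with hCdef
  have hC : 0 < C := by rw [hCdef]; exact_mod_cast Nat.choose_pos hn
  have hN : ((Fintype.card (Fin n → ZMod 2) : ℕ) : ℝ) = 2^n := by
    simp [ZMod.card]
  set T : ℝ := 2 * C * Real.log 2 with hT
  set β : ℝ := Real.sqrt (T / 2^n) with hβ
  have hTpos : 0 < T := by positivity
  have hβpos : 0 < β := Real.sqrt_pos.mpr (by positivity)
  have hβsq : β^2 = T / 2^n := Real.sq_sqrt (by positivity)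
  have main := lower_max (Gf (s+1) n) (Gf_nonempty (s+1) n) β η T (((2 ^ (Dm s n)) ^ t : ℕ) : ℝ)
    hβpos hη hη1 (by rw [hN, hβsq]; field_simp) (by
      rw [hβsq, hT]
      rw [le_div_iff₀ (by positivity)] at h1
      have : 2 * C * Real.log 2 / 2^n = C / 2^n * (2 * Real.log 2) := by ring
      rw [this]; exact h1) (by
      rw [div_le_iff₀ (by positivity), div_le_iff₀ (by positivity)] at h2
      rw [hT]; linarith) Fintype.card_pos (by
      have e1 : Real.exp (T/2) = 2 ^ (n.choose (s+1)) := by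
        rw [hT, show 2 * C * Real.log 2 / 2 = C * Real.log 2 by ring, hCdef, Real.exp_nat_mul,
          Real.exp_log (by norm_num)]
      rw [e1, card_Gf]
      exact_mod_cast le_card_RMs (s+1) n) (by
      intro g hg
      rw [hN]
      have := ht n
      refine le_trans ?_ (Nat.cast_le.mpr this)
      apply Nat.cast_le.mpr
      apply Finset.card_le_card_of_injOn (fun h => g + h)
      · intro h hh
        rw [Finset.mem_coe, Finset.mem_filter] at hh ⊢
        refine ⟨?_, hh.2⟩
        rw [mem_Gf] at hg ⊢
        exact Submodule.add_mem _ hg ((mem_Gf _).mp hh.1)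
      · intro h _ k _ heq
        exact add_left_cancel heq) (by
      push_cast
      rw [← pow_mul]
      have e1 : (2:ℝ)^(Dm s n * t) = Real.exp ((Dm s n * t : ℕ) * Real.log 2) := by
        rw [Real.exp_nat_mul, Real.exp_log (by norm_num)]
      rw [e1]
      apply Real.exp_le_exp.mpr
      rw [div_le_div_iff₀ hC (by positivity)] at h3
      have hDn : (0:ℝ) ≤ Dm s n := Nat.cast_nonneg _
      have h4 : (Dm s n : ℝ) * t ≤ 2 * η * C := by linarith
      have h5 := mul_le_mul_of_nonneg_right h4 hl.le
      push_cast
      rw [hT]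
      linarith)
  rw [hN] at main
  have hden : β * 2^n = 2 * Real.sqrt (2^(n-1) * C * Real.log 2) := by
    have hp : (2:ℝ)^n = 2 * 2^(n-1) := by rw [← pow_succ']; congr 1; omega
    have e1 : β * 2^n = Real.sqrt (T * 2^n) := by
      rw [hβ]
      have : Real.sqrt (T / 2^n) * 2^n = Real.sqrt (T / 2^n) * Real.sqrt ((2^n)^2) := by
        rw [Real.sqrt_sq (by positivity)]
      rw [this, ← Real.sqrt_mul (by positivity)]
      congr 1
      field_simp
    rw [e1, two_mul_sqrt]
    congr 1
    rw [hp, hT]; ring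
  rw [hden] at main
  rw [div_div, le_div_iff₀ (by positivity)]
  linarith

theorem stmt1 (r : ℕ) (hr : 1 ≤ r) :
    Tendsto (fun n : ℕ =>
      ((2:ℝ)^(n-1) - (∑ g : BF n, (nonlin r g : ℝ)) / 2^(2^n)) /
        Real.sqrt (2^(n-1) * (n.choose r) * Real.log 2)) atTop (nhds 1) := by
  obtain ⟨s, rfl⟩ : ∃ s, r = s + 1 := ⟨r - 1, by omega⟩
  have heq : ∀ᶠ n : ℕ in atTop,
      Ex (Mx (Gf (s+1) n) (Gf_nonempty (s+1) n)) / 2 /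
        Real.sqrt (2^(n-1) * (n.choose (s+1)) * Real.log 2) =
      ((2:ℝ)^(n-1) - (∑ g : BF n, (nonlin (s+1) g : ℝ)) / 2^(2^n)) /
        Real.sqrt (2^(n-1) * (n.choose (s+1)) * Real.log 2) := by
    filter_upwards [eventually_ge_atTop 1] with n hn
    congr 1
    have hp : (2:ℝ)^n = 2 * 2^(n-1) := by rw [← pow_succ']; congr 1; omega
    rw [Enonlin, hp]
    ring
  refine Tendsto.congr' heq ?_
  rw [tendsto_order]
  constructor
  · intro c hc
    have hcont : Tendsto (fun η : ℝ => 1 - η - 4 * Real.sqrt η) (nhdsWithin 0 (Set.Ioi 0)) (nhds 1) := by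
      have : Continuous (fun η : ℝ => 1 - η - 4 * Real.sqrt η) := by fun_prop
      have h := this.tendsto 0
      simp only [Real.sqrt_zero, mul_zero, sub_zero] at h
      exact h.mono_left nhdsWithin_le_nhds
    have e1 := hcont.eventually_const_lt hc
    have e2 : ∀ᶠ η : ℝ in nhdsWithin 0 (Set.Ioi 0), η ∈ Set.Ioc (0:ℝ) 1 :=
      Ioc_mem_nhdsGT (by norm_num)
    obtain ⟨η, h1, h2⟩ := (e1.and e2).exists
    filter_upwards [ratio_lower s η h2.1 h2.2] with n hn
    exact lt_of_lt_of_le h1 hn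
  · intro c hc
    have h1 : Tendsto (fun n : ℕ => Real.sqrt (1 + (Dm s n : ℝ) / (n.choose (s+1) : ℝ))) atTop
        (nhds 1) := by
      have := ((Dm_ratio s).const_add 1).sqrt
      simpa using this
    filter_upwards [h1.eventually_lt_const hc, eventually_ge_atTop (s+1)] with n hn hn2
    exact lt_of_le_of_lt (ratio_upper s n hn2) hn
end
end

section
/- For every integer r ≥ 1 there exists a constant K_r such that for all n ≥ 1 and all real δ with 0 < δ ≤ 1/2, the number of Boolean functions g ∈ RM(r,n) with wt(g) ≤ 2ⁿ·(1−δ)/2 is at most (1/δ)^{K_r·n^{r−1}}. -/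
open MeasureTheory ProbabilityTheory Filter Real

noncomputable section

section aux
variable {n : ℕ}

lemma RM_mono {d e : ℕ} (h : d ≤ e) {g : BF n} (hg : g ∈ RM d n) : g ∈ RM e n := by
  obtain ⟨p, hp, h2⟩ := hg
  exact ⟨p, hp.trans h, h2⟩

lemma RM_add {d : ℕ} {g h : BF n} (hg : g ∈ RM d n) (hh : h ∈ RM d n) : g + h ∈ RM d n := by
  obtain ⟨p, hp, h2⟩ := hg
  obtain ⟨q, hq, h3⟩ := hh
  exact ⟨p + q, (MvPolynomial.totalDegree_add p q).trans (max_le hp hq), fun x => by simp [h2, h3]⟩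

lemma RM_mul {d e : ℕ} {g h : BF n} (hg : g ∈ RM d n) (hh : h ∈ RM e n) : g * h ∈ RM (d + e) n := by
  obtain ⟨p, hp, h2⟩ := hg
  obtain ⟨q, hq, h3⟩ := hh
  exact ⟨p * q, (MvPolynomial.totalDegree_mul p q).trans (add_le_add hp hq), fun x => by simp [h2, h3]⟩

lemma RM_const (d : ℕ) (c : ZMod 2) : (fun _ => c : BF n) ∈ RM d n :=
  ⟨MvPolynomial.C c, by simp, fun x => by simp⟩

lemma RM_X (i : Fin n) : (fun x => x i : BF n) ∈ RM 1 n :=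
  ⟨MvPolynomial.X i, by simp, fun x => by simp⟩

lemma RM_zero {g : BF n} (hg : g ∈ RM 0 n) : ∃ c, g = fun _ => c := by
  obtain ⟨p, hp, h2⟩ := hg
  have := MvPolynomial.totalDegree_eq_zero_iff_eq_C.1 (Nat.le_zero.1 hp)
  refine ⟨MvPolynomial.coeff 0 p, ?_⟩
  funext x
  rw [← h2, this]; simp

lemma RM_sum {ι : Type*} (s : Finset ι) {d : ℕ} (f : ι → BF n) (h : ∀ i ∈ s, f i ∈ RM d n) :
    ∑ i ∈ s, f i ∈ RM d n := by
  classical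
  induction s using Finset.induction_on with
  | empty => exact RM_const d 0
  | insert a s ha ih =>
    rw [Finset.sum_insert ha]
    exact RM_add (h a (by simp)) (ih fun i hi => h i (by simp [hi]))

/-- Decomposition of functions of degree at most `d + 1`. -/
lemma RM_decomp {d : ℕ} {g : BF n} (hg : g ∈ RM (d + 1) n) :
    ∃ G : Option (Fin n) → RM d n,
      g = fun x => (G none).1 x + ∑ i, x i * (G (some i)).1 x := by
  classical
  -- the set of decomposable functions is closed under sums
  let P : BF n → Prop := fun g => ∃ (g0 : BF n) (G : Fin n → BF n), g0 ∈ RM d n ∧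
    (∀ i, G i ∈ RM d n) ∧ g = fun x => g0 x + ∑ i, x i * G i x
  have hadd : ∀ f g, P f → P g → P (f + g) := by
    rintro f g ⟨f0, F, a1, a2, rfl⟩ ⟨g0, G, b1, b2, rfl⟩
    refine ⟨f0 + g0, fun i => F i + G i, RM_add a1 b1, fun i => RM_add (a2 i) (b2 i), ?_⟩
    funext x
    simp only [Pi.add_apply, mul_add, Finset.sum_add_distrib]
    ring
  have h0 : P 0 := ⟨0, fun _ => 0, RM_const d 0, fun _ => RM_const d 0, by funext x; simp⟩
  obtain ⟨p, hp, h2⟩ := hg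
  have hmon : ∀ s ∈ p.support, P (fun x => MvPolynomial.eval x (MvPolynomial.monomial s (p.coeff s))) := by
    intro s hs
    have hdeg : (s.sum fun _ e => e) ≤ d + 1 := (MvPolynomial.le_totalDegree hs).trans hp
    by_cases hs0 : s = 0
    · subst hs0
      exact ⟨fun _ => p.coeff 0, fun _ => 0, RM_const d _, fun _ => RM_const d 0, by
        funext x; simp⟩
    · obtain ⟨i, hi⟩ := Finsupp.ne_iff.1 hs0
      have hle : Finsupp.single i 1 ≤ s := by
        rw [Finsupp.single_le_iff]; simp at hi; omega
      obtain ⟨t, rfl⟩ := exists_add_of_le hle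
      rw [Finsupp.sum_add_index' (by simp) (by simp), Finsupp.sum_single_index (by simp)] at hdeg
      set c := p.coeff (Finsupp.single i 1 + t)
      refine ⟨0, fun j => if j = i then (fun x => MvPolynomial.eval x (MvPolynomial.monomial t c)) else 0,
        RM_const d 0, ?_, ?_⟩
      · intro j
        dsimp only
        split_ifs
        · refine ⟨MvPolynomial.monomial t c, ?_, fun x => rfl⟩
          refine (MvPolynomial.totalDegree_monomial_le _ _).trans ?_
          change (t.sum fun _ e => e) ≤ d
          omega
        · exact RM_const d 0
      · funext x
        have : MvPolynomial.monomial (Finsupp.single i 1 + t) c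
            = MvPolynomial.X i * MvPolynomial.monomial t c := by
          rw [MvPolynomial.X, MvPolynomial.monomial_mul, one_mul]
        rw [this, Finset.sum_eq_single i]
        · simp
        · intro j _ hj; simp [hj]
        · simp
  have hsum : ∀ s : Finset (Fin n →₀ ℕ), s ⊆ p.support →
      P (fun x => MvPolynomial.eval x (∑ v ∈ s, MvPolynomial.monomial v (p.coeff v))) := by
    intro s
    induction s using Finset.induction_on with
    | empty => intro _; simp only [Finset.sum_empty, map_zero]; exact h0
    | insert a s ha ih =>
      intro hs
      have := hadd _ _ (hmon a (hs (by simp))) (ih fun i hi => hs (by simp [hi]))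
      rw [Finset.sum_insert ha]
      convert this using 1
      funext x; simp only [map_add, Pi.add_apply]
  have := hsum p.support (Finset.Subset.refl _)
  rw [← MvPolynomial.as_sum] at this
  obtain ⟨g0, G, a1, a2, a3⟩ := this
  refine ⟨fun o => match o with
    | none => ⟨g0, a1⟩
    | some i => ⟨G i, a2 i⟩, ?_⟩
  funext x
  rw [← h2]
  exact congrFun a3 x

lemma card_RM_le (d : ℕ) : Nat.card (RM d n) ≤ 2 ^ ((n + 1) ^ d) := by
  classical
  induction d with
  | zero =>
    have hs : Function.Surjective (fun c : ZMod 2 => (⟨fun _ => c, RM_const 0 c⟩ : RM 0 n)) := by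
      rintro ⟨g, hg⟩
      obtain ⟨c, rfl⟩ := RM_zero hg
      exact ⟨c, rfl⟩
    simpa using Nat.card_le_card_of_surjective _ hs
  | succ d ih =>
    have hmem : ∀ G : Option (Fin n) → RM d n,
        (fun x => (G none).1 x + ∑ i, x i * (G (some i)).1 x : BF n) ∈ RM (d + 1) n := by
      intro G
      have h1 := RM_add (RM_mono (Nat.le_succ d) (G none).2)
        (RM_sum Finset.univ (fun i => (fun x => x i : BF n) * (G (some i)).1)
          (fun i _ => by rw [Nat.succ_eq_add_one, add_comm]; exact RM_mul (RM_X i) (G (some i)).2))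
      convert h1 using 1
      funext x
      simp
    have hs : Function.Surjective (fun G : Option (Fin n) → RM d n => (⟨_, hmem G⟩ : RM (d + 1) n)) := by
      rintro ⟨g, hg⟩
      obtain ⟨G, hG⟩ := RM_decomp hg
      exact ⟨G, Subtype.ext hG.symm⟩
    have := Nat.card_le_card_of_surjective _ hs
    refine this.trans ?_
    rw [Nat.card_fun, pow_succ, pow_mul]
    simp only [Nat.card_eq_fintype_card, Fintype.card_option, Fintype.card_fin]
    rw [← Nat.card_eq_fintype_card]
    exact Nat.pow_le_pow_left ih _

/-- Discrete derivative. -/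
def der (a : Fin n → ZMod 2) (g : BF n) : BF n := fun x => g (x + a) - g x

lemma der_RM (a : Fin n → ZMod 2) (d : ℕ) : ∀ g : BF n, g ∈ RM (d + 1) n → der a g ∈ RM d n := by
  -- statement including degree zero
  induction d with
  | zero =>
    intro g hg
    obtain ⟨G, rfl⟩ := RM_decomp hg
    choose c hc using fun o => RM_zero (G o).2
    have : der a (fun x => (G none).1 x + ∑ i, x i * (G (some i)).1 x)
        = fun _ => ∑ i, a i * c (some i) := by
      funext x
      simp only [der, hc, Pi.add_apply, add_mul, Finset.sum_add_distrib]
      ring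
    rw [this]
    exact RM_const 0 _
  | succ d ih =>
    intro g hg
    obtain ⟨G, rfl⟩ := RM_decomp hg
    have : der a (fun x => (G none).1 x + ∑ i, x i * (G (some i)).1 x)
        = der a (G none).1 + ∑ i, (((fun x => x i : BF n) + fun _ => a i) * der a (G (some i)).1
          + (fun _ => a i : BF n) * (G (some i)).1) := by
      funext x
      simp only [der, Pi.add_apply, Pi.mul_apply, Finset.sum_apply]
      rw [add_sub_add_comm, ← Finset.sum_sub_distrib]
      congr 1
      refine Finset.sum_congr rfl fun i _ => ?_
      ring
    rw [this]
    refine RM_add (RM_mono (Nat.le_succ d) (ih _ (G none).2)) (RM_sum _ _ fun i _ => RM_add ?_ ?_)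
    · exact RM_mono (add_comm 1 d).le (RM_mul (RM_add (RM_X i) (RM_const 1 _)) (ih _ (G (some i)).2))
    · have := RM_mul (RM_const 0 (a i)) (G (some i)).2
      rwa [zero_add] at this

open Classical in
lemma RM_min_wt (d : ℕ) : ∀ g : BF n, g ∈ RM d n → g ≠ 0 →
    2 ^ n ≤ (Finset.univ.filter fun x => g x ≠ 0).card * 2 ^ d := by
  have hconst : ∀ c : ZMod 2, (fun _ => c : BF n) ≠ 0 →
      (Finset.univ.filter fun x : Fin n → ZMod 2 => (fun _ => c : BF n) x ≠ 0).card = 2 ^ n := by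
    intro c hc
    have : c ≠ 0 := by rintro rfl; exact hc rfl
    simp [this]
  induction d with
  | zero =>
    intro g hg h0
    obtain ⟨c, rfl⟩ := RM_zero hg
    rw [hconst c h0]; simp
  | succ d ih =>
    intro g hg h0
    by_cases h : ∃ a, der a g ≠ 0
    · obtain ⟨a, ha⟩ := h
      have h1 := ih _ (der_RM a d g hg) ha
      have h2 : (Finset.univ.filter fun x => der a g x ≠ 0).card ≤
          (Finset.univ.filter fun x => g (x + a) ≠ 0).card
          + (Finset.univ.filter fun x => g x ≠ 0).card := by
        refine le_trans (Finset.card_le_card ?_) (Finset.card_union_le _ _)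
        intro x hx
        replace hx := (Finset.mem_filter.1 hx).2
        simp only [Finset.mem_filter, Finset.mem_univ, true_and, Finset.mem_union]
        by_contra hcon
        push Not at hcon
        exact hx (by rw [der, hcon.1, hcon.2, sub_self])
      have h3 : (Finset.univ.filter fun x => g (x + a) ≠ 0).card =
          (Finset.univ.filter fun x => g x ≠ 0).card := by
        refine Finset.card_bij (fun x _ => x + a) ?_ ?_ ?_
        · intro x; simp
        · intro x _ y _ hxy; exact add_right_cancel hxy
        · intro y hy; exact ⟨y - a, by simpa using hy, by simp⟩
      rw [h3] at h2
      calc 2 ^ n ≤ _ := h1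
        _ ≤ _ := Nat.mul_le_mul_right _ h2
        _ = _ := by ring
    · push Not at h
      have : g = fun _ => g 0 := by
        funext x
        have := congrFun (h x) 0
        simp only [der, zero_add, Pi.zero_apply] at this
        exact sub_eq_zero.1 this
      rw [this] at h0 ⊢
      rw [hconst _ h0]
      exact Nat.le_mul_of_pos_right _ (by positivity)

end aux

section second
variable {n k : ℕ}

/-- Linear combination of the directions `a`. -/
def lc (c : Fin k → ZMod 2) (a : Fin k → Fin n → ZMod 2) : Fin n → ZMod 2 := ∑ i, c i • a i

lemma sum_lc (F : (Fin n → ZMod 2) → ℝ) (hF : ∑ y, F y = 0) (c : Fin k → ZMod 2) (hc : c ≠ 0) :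
    ∑ a : Fin k → Fin n → ZMod 2, F (lc c a) = 0 := by
  classical
  obtain ⟨i, hi⟩ := Function.ne_iff.1 hc
  have hi1 : c i = 1 := by
    have : ∀ z : ZMod 2, z ≠ 0 → z = 1 := by decide
    exact this _ hi
  have h1 : ∀ y : Fin n → ZMod 2, ∑ a : Fin k → Fin n → ZMod 2, F (lc c a)
      = ∑ a : Fin k → Fin n → ZMod 2, F (lc c a + y) := by
    intro y
    rw [← Equiv.sum_comp (Equiv.addRight (Pi.single i y : Fin k → Fin n → ZMod 2))]
    refine Finset.sum_congr rfl fun a _ => ?_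
    congr 1
    simp only [lc, Equiv.coe_addRight, Pi.add_apply, smul_add, Finset.sum_add_distrib]
    congr 1
    rw [Finset.sum_eq_single i]
    · simp [hi1]
    · intro j _ hj; simp [hj]
    · simp
  have h2 : ∑ y : Fin n → ZMod 2, ∑ a : Fin k → Fin n → ZMod 2, F (lc c a) = 0 := by
    rw [Finset.sum_congr rfl fun y _ => h1 y, Finset.sum_comm]
    refine Finset.sum_eq_zero fun a _ => ?_
    rw [← hF]
    exact Equiv.sum_comp (Equiv.addLeft (lc c a)) F
  rw [Finset.sum_const, nsmul_eq_mul] at h2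
  refine (mul_eq_zero.1 h2).resolve_left ?_
  simp

lemma second_moment (f : (Fin n → ZMod 2) → ℝ) (hf : ∑ y, f y = 0) :
    ∑ a : Fin k → Fin n → ZMod 2, ∑ x, (∑ c : Fin k → ZMod 2, f (x + lc c a)) ^ 2
      = 2 ^ k * (2 ^ n) ^ k * ∑ x, f x ^ 2 := by
  classical
  have hpair : ∀ c d : Fin k → ZMod 2,
      ∑ a : Fin k → Fin n → ZMod 2, ∑ x, f (x + lc c a) * f (x + lc d a)
       = if c = d then (2 ^ n) ^ k * ∑ x, f x ^ 2 else 0 := by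
    intro c d
    have h1 : ∀ a : Fin k → Fin n → ZMod 2, ∑ x, f (x + lc c a) * f (x + lc d a)
        = ∑ x, f x * f (x + lc (d - c) a) := by
      intro a
      rw [← Equiv.sum_comp (Equiv.addRight (lc c a)) (fun x => f x * f (x + lc (d - c) a))]
      refine Finset.sum_congr rfl fun x _ => ?_
      simp only [Equiv.coe_addRight]
      congr 2
      simp only [lc, Pi.sub_apply, sub_smul, Finset.sum_sub_distrib]
      abel
    rw [Finset.sum_congr rfl fun a _ => h1 a]
    split_ifs with h
    · subst h
      simp [lc, pow_two]
    · rw [Finset.sum_comm]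
      refine Finset.sum_eq_zero fun x _ => ?_
      rw [← Finset.mul_sum, sum_lc (fun y => f (x + y)) _ _ (sub_ne_zero.2 (Ne.symm h)), mul_zero]
      rw [← hf]
      exact Equiv.sum_comp (Equiv.addLeft x) f
  calc _ = ∑ c : Fin k → ZMod 2, ∑ d : Fin k → ZMod 2,
        ∑ a : Fin k → Fin n → ZMod 2, ∑ x, f (x + lc c a) * f (x + lc d a) := by
        simp only [pow_two, Finset.sum_mul_sum]
        rw [Finset.sum_congr rfl fun a _ => Finset.sum_comm]
        rw [Finset.sum_comm]
        refine Finset.sum_congr rfl fun c _ => ?_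
        rw [Finset.sum_congr rfl fun a _ => Finset.sum_comm]
        rw [Finset.sum_comm]
    _ = _ := by
        simp only [hpair]
        simp [mul_assoc]

/-- Sign of a Boolean function. -/
def chi (g : BF n) (x : Fin n → ZMod 2) : ℝ := if g x = 0 then 1 else -1

/-- Bad points. -/
def bad (g : BF n) (a : Fin k → Fin n → ZMod 2) : Finset (Fin n → ZMod 2) :=
  Finset.univ.filter fun x => ∑ c : Fin k → ZMod 2, chi g (x + lc c a) ≤ 0

lemma sum_chi (g : BF n) : ∑ x, chi g x = 2 ^ n - 2 * (wt g : ℝ) := by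
  classical
  have h1 : ∀ x, chi g x = 1 - 2 * (if g x ≠ 0 then 1 else 0) := by
    intro x; unfold chi; split_ifs <;> first | contradiction | norm_num
  simp only [h1, Finset.sum_sub_distrib, ← Finset.mul_sum]
  have : (wt g : ℝ) = ∑ x, (if g x ≠ 0 then (1:ℝ) else 0) := by
    rw [Finset.sum_boole, wt, Nat.card_eq_fintype_card, Fintype.card_subtype]
    rfl
  rw [this]
  simp

lemma sum_bad (g : BF n) {δ : ℝ} (hδ : 0 < δ) (hg : (wt g : ℝ) ≤ 2 ^ n * (1 - δ) / 2) :
    (∑ a : Fin k → Fin n → ZMod 2, ((bad g a).card : ℝ)) * (2 ^ k * δ ^ 2) ≤ (2 ^ n) ^ k * 2 ^ n := by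
  classical
  set B := ∑ x, chi g x with hB
  have hBδ : δ * 2 ^ n ≤ B := by rw [hB, sum_chi]; linarith
  set β : ℝ := B / 2 ^ n with hβ
  have hN : (0:ℝ) < 2 ^ n := by positivity
  have hβδ : δ ≤ β := by rw [hβ, le_div_iff₀ hN]; exact hBδ
  have hBN : B = β * 2 ^ n := by rw [hβ]; field_simp
  let f : (Fin n → ZMod 2) → ℝ := fun x => chi g x - β
  have hf0 : ∑ x, f x = 0 := by
    simp only [f, Finset.sum_sub_distrib, ← hB]
    simp [hBN]; ring
  have hf2 : ∑ x, f x ^ 2 ≤ 2 ^ n := by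
    have : ∀ x, f x ^ 2 = 1 - 2 * β * chi g x + β ^ 2 := by
      intro x
      have : chi g x ^ 2 = 1 := by unfold chi; split_ifs <;> norm_num
      simp only [f]; linear_combination this
    simp only [this, Finset.sum_add_distrib, Finset.sum_sub_distrib, ← Finset.mul_sum, ← hB]
    simp [hBN]
    nlinarith [mul_nonneg hN.le (sq_nonneg β)]
  have hsm := second_moment (k := k) f hf0
  have hlow : ∀ a : Fin k → Fin n → ZMod 2, ((bad g a).card : ℝ) * (2 ^ k * δ) ^ 2 ≤
      ∑ x, (∑ c : Fin k → ZMod 2, f (x + lc c a)) ^ 2 := by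
    intro a
    rw [← nsmul_eq_mul, ← Finset.sum_const]
    refine le_trans (Finset.sum_le_sum (g := fun x => (∑ c : Fin k → ZMod 2, f (x + lc c a)) ^ 2) ?_)
      (Finset.sum_le_sum_of_subset_of_nonneg (Finset.subset_univ _) fun x _ _ => sq_nonneg _)
    intro x hx
    have hx := (Finset.mem_filter.1 hx).2
    have : ∑ c : Fin k → ZMod 2, f (x + lc c a) ≤ - (2 ^ k * δ) := by
      simp only [f, Finset.sum_sub_distrib]
      simp
      have : (2:ℝ) ^ k * δ ≤ 2 ^ k * β := by gcongr
      linarith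
    have h0 : (0:ℝ) < 2 ^ k * δ := by positivity
    nlinarith
  have h3 := Finset.sum_le_sum (s := Finset.univ) fun a _ => hlow a
  rw [hsm, ← Finset.sum_mul] at h3
  have h4 : (2:ℝ) ^ k * (2 ^ n) ^ k * ∑ x, f x ^ 2 ≤ 2 ^ k * (2 ^ n) ^ k * 2 ^ n := by gcongr
  have hk : (0:ℝ) < 2 ^ k := by positivity
  refine le_of_mul_le_mul_left ?_ hk
  calc _ = _ := by ring
    _ ≤ _ := h3.trans h4
    _ = _ := by ring

lemma inv_lc (h : BF n) (a : Fin k → Fin n → ZMod 2) (hh : ∀ i x, h (x + a i) = h x)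
    (c : Fin k → ZMod 2) (x : Fin n → ZMod 2) : h (x + lc c a) = h x := by
  classical
  unfold lc
  have : ∀ s : Finset (Fin k), h (x + ∑ i ∈ s, c i • a i) = h x := by
    intro s
    induction s using Finset.induction_on with
    | empty => simp
    | insert j s hj ih =>
      rw [Finset.sum_insert hj, add_comm (c j • a j), ← add_assoc]
      have hz : ∀ z : ZMod 2, z = 0 ∨ z = 1 := by decide
      rcases hz (c j) with h0 | h0
      · rw [h0, zero_smul, add_zero, ih]
      · rw [h0, one_smul, hh, ih]
  exact this _

lemma good_inj {r : ℕ} {g g' : BF n} (hg : g ∈ RM r n) (hg' : g' ∈ RM r n)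
    (a : Fin k → Fin n → ZMod 2) (hb : (bad g a).card * 2 ^ (r + 1) < 2 ^ n)
    (hb' : (bad g' a).card * 2 ^ (r + 1) < 2 ^ n) (hd : ∀ i, der (a i) g = der (a i) g') :
    g = g' := by
  classical
  by_contra hne
  have hz : ∀ z w : ZMod 2, z + w = 0 ↔ z = w := by decide
  have hinv : ∀ i x, (g + g') (x + a i) = (g + g') x := by
    intro i x
    have := congrFun (hd i) x
    simp only [der, Pi.add_apply] at this ⊢
    generalize g (x + a i) = p at *
    generalize g' (x + a i) = q at *
    generalize g x = s at *
    generalize g' x = t at *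
    revert p q s t
    decide
  have hsum : g + g' ≠ 0 := by
    intro h0
    apply hne
    funext x
    exact (hz _ _).1 (congrFun h0 x)
  have h1 := RM_min_wt r _ (RM_add hg hg') hsum
  have h2 : (Finset.univ.filter fun x => (g + g') x ≠ 0).card ≤ (bad g a).card + (bad g' a).card := by
    refine le_trans (Finset.card_le_card ?_) (Finset.card_union_le _ _)
    intro x hx
    replace hx := (Finset.mem_filter.1 hx).2
    have hneg : ∀ c, chi g' (x + lc c a) = - chi g (x + lc c a) := by
      intro c
      have h3 := inv_lc (g + g') a hinv c x
      rw [← h3] at hx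
      have hc : ∀ z w : ZMod 2, z + w ≠ 0 → (z = 0 ↔ w ≠ 0) := by decide
      have := hc _ _ hx
      unfold chi
      by_cases h4 : g (x + lc c a) = 0
      · simp [h4, this.1 h4]
      · have h5 : g' (x + lc c a) = 0 := by
          by_contra h6; exact h4 (this.2 h6)
        simp [h4, h5]
    rw [Finset.mem_union, bad, bad, Finset.mem_filter, Finset.mem_filter]
    simp only [hneg, Finset.sum_neg_distrib, Finset.mem_univ, true_and]
    rcases le_total (∑ c : Fin k → ZMod 2, chi g (x + lc c a)) 0 with h | h
    · exact Or.inl h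
    · exact Or.inr (by linarith)
  have h3 := Nat.mul_le_mul_right (2 ^ r) h2
  rw [pow_succ] at hb hb'
  have h4 : 2 ^ n ≤ ((bad g a).card + (bad g' a).card) * 2 ^ r := le_trans (by convert h1) h3
  nlinarith

open Classical in
lemma main_count {r k n : ℕ} {δ : ℝ} (hδ : 0 < δ) (hk : (2:ℝ) ^ (r + 4) ≤ 2 ^ k * δ ^ 2) :
    Nat.card {g : BF n | g ∈ RM (r + 1) n ∧ (wt g : ℝ) ≤ 2^n * (1 - δ) / 2}
      ≤ 2 * 2 ^ ((n + 1) ^ r * k) := by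
  set S : Finset (BF n) :=
    Finset.univ.filter fun g => g ∈ RM (r + 1) n ∧ (wt g : ℝ) ≤ 2^n * (1 - δ) / 2 with hS
  have hcard : Nat.card {g : BF n | g ∈ RM (r + 1) n ∧ (wt g : ℝ) ≤ 2^n * (1 - δ) / 2} = S.card := by
    rw [Nat.card_eq_fintype_card, Fintype.card_subtype]
    rfl
  rw [hcard]
  let good : (Fin k → Fin n → ZMod 2) → BF n → Prop := fun a g =>
    (bad g a).card * 2 ^ (r + 1 + 1) < 2 ^ n
  have hNk : (Fintype.card (Fin k → Fin n → ZMod 2)) = (2 ^ n) ^ k := by simp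
  -- each g has many good a
  have hgood : ∀ g ∈ S, (2 ^ n) ^ k ≤ 2 * (Finset.univ.filter fun a => good a g).card := by
    intro g hg
    have hg := (Finset.mem_filter.1 hg).2
    have h1 := sum_bad (k := k) g hδ hg.2
    have h2 : (∑ a : Fin k → Fin n → ZMod 2, ((bad g a).card : ℝ)) * 2 ^ (r + 4)
        ≤ (2 ^ n) ^ k * 2 ^ n :=
      le_trans (mul_le_mul_of_nonneg_left hk (Finset.sum_nonneg fun _ _ => Nat.cast_nonneg _)) h1
    have h3 : (∑ a : Fin k → Fin n → ZMod 2, (bad g a).card) * 2 ^ (r + 4)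
        ≤ (2 ^ n) ^ k * 2 ^ n := by exact_mod_cast h2
    have h4 : (Finset.univ.filter fun a => ¬ good a g).card * 2 ^ n
        ≤ (∑ a : Fin k → Fin n → ZMod 2, (bad g a).card) * 2 ^ (r + 2) := by
      rw [Finset.sum_mul, ← smul_eq_mul, ← Finset.sum_const]
      refine le_trans (Finset.sum_le_sum (g := fun a => (bad g a).card * 2 ^ (r + 2)) ?_)
        (Finset.sum_le_sum_of_subset (Finset.subset_univ _))
      intro a ha
      exact not_lt.1 (Finset.mem_filter.1 ha).2
    have h5 := Finset.card_filter_add_card_filter_not (s := Finset.univ)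
      (fun a : Fin k → Fin n → ZMod 2 => good a g)
    rw [Finset.card_univ, hNk] at h5
    have h6 : (Finset.univ.filter fun a => ¬ good a g).card * 4 ≤ (2 ^ n) ^ k := by
      refine Nat.le_of_mul_le_mul_right ?_ (show 0 < 2 ^ n by positivity)
      calc _ = (Finset.univ.filter fun a => ¬ good a g).card * 2 ^ n * 4 := by ring
        _ ≤ _ := Nat.mul_le_mul_right 4 h4
        _ = (∑ a : Fin k → Fin n → ZMod 2, (bad g a).card) * 2 ^ (r + 4) := by ring
        _ ≤ _ := h3
    omega
  -- averaging
  obtain ⟨a, ha⟩ : ∃ a, S.card ≤ 2 * (S.filter fun g => good a g).card := by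
    by_contra hcon
    push Not at hcon
    have h1 : ∑ a : Fin k → Fin n → ZMod 2, 2 * (S.filter fun g => good a g).card
        < ∑ a : Fin k → Fin n → ZMod 2, S.card :=
      Finset.sum_lt_sum_of_nonempty Finset.univ_nonempty fun a _ => hcon a
    rw [Finset.sum_const, Finset.card_univ, hNk, ← Finset.mul_sum] at h1
    have h2 : ∑ a : Fin k → Fin n → ZMod 2, (S.filter fun g => good a g).card
        = ∑ g ∈ S, (Finset.univ.filter fun a => good a g).card :=
      Finset.sum_card_bipartiteAbove_eq_sum_card_bipartiteBelow good
    rw [h2, Finset.mul_sum] at h1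
    have h3 := Finset.sum_le_sum hgood
    rw [Finset.sum_const] at h3
    simp only [smul_eq_mul] at h1 h3
    rw [mul_comm] at h1
    omega
  refine ha.trans (Nat.mul_le_mul_left 2 ?_)
  have hmem : ∀ g : (S.filter fun g => good a g), g.1 ∈ RM (r + 1) n ∧ good a g.1 := by
    intro g
    have := Finset.mem_filter.1 g.2
    exact ⟨(Finset.mem_filter.1 this.1).2.1, this.2⟩
  let Φ : (S.filter fun g => good a g) → (Fin k → RM r n) := fun g i =>
    ⟨der (a i) g.1, der_RM (a i) r _ (hmem g).1⟩
  have hΦ : Function.Injective Φ := by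
    intro g g' hgg
    apply Subtype.ext
    refine good_inj (hmem g).1 (hmem g').1 a (hmem g).2 (hmem g').2 fun i => ?_
    exact congrArg Subtype.val (congrFun hgg i)
  have := Nat.card_le_card_of_injective Φ hΦ
  rw [Nat.card_fun, Nat.card_eq_fintype_card, Fintype.card_coe] at this
  refine this.trans ?_
  rw [pow_mul]
  simp only [Nat.card_eq_fintype_card, Fintype.card_fin]
  rw [← Nat.card_eq_fintype_card]
  exact Nat.pow_le_pow_left (card_RM_le r) _

end second

theorem stmt9 (r : ℕ) (hr : 1 ≤ r) :
    ∃ K : ℝ, ∀ n : ℕ, 1 ≤ n → ∀ δ : ℝ, 0 < δ → δ ≤ 1/2 →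
      (Nat.card {g : BF n | g ∈ RM r n ∧ (wt g : ℝ) ≤ 2^n * (1 - δ) / 2} : ℝ)
        ≤ (1/δ) ^ (K * (n : ℝ)^(r-1)) := by
  obtain ⟨r, rfl⟩ : ∃ s, r = s + 1 := ⟨r - 1, by omega⟩
  simp only [Nat.add_sub_cancel]
  refine ⟨(r + 9) * 2 ^ r, fun n hn δ hδ hδ2 => ?_⟩
  set L := Real.logb 2 (1 / δ) with hL
  have hL1 : 1 ≤ L := by
    rw [hL, Real.le_logb_iff_rpow_le (by norm_num) (by positivity), Real.rpow_one,
      le_div_iff₀ hδ]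
    linarith
  have hpow : (2:ℝ) ^ L = 1 / δ := Real.rpow_logb (by norm_num) (by norm_num) (by positivity)
  set m := ⌈L⌉₊ with hm
  have hmL : L ≤ m := Nat.le_ceil L
  have hmL2 : (m : ℝ) ≤ 2 * L := by
    have := (Nat.ceil_lt_add_one (show 0 ≤ L by linarith)).le
    linarith
  have h2m : 1 / δ ≤ (2:ℝ) ^ m := by
    rw [← hpow, ← Real.rpow_natCast]
    exact Real.rpow_le_rpow_of_exponent_le (by norm_num) hmL
  have h2m' : 1 ≤ (2:ℝ) ^ m * δ := by
    rwa [div_le_iff₀ hδ] at h2m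
  have hk : (2:ℝ) ^ (r + 4) ≤ 2 ^ (r + 4 + 2 * m) * δ ^ 2 := by
    calc (2:ℝ) ^ (r + 4) = 2 ^ (r + 4) * 1 := by ring
      _ ≤ 2 ^ (r + 4) * (2 ^ m * δ) ^ 2 := by
        gcongr
        exact one_le_pow₀ h2m'
      _ = _ := by ring
  have hmain := main_count (n := n) hδ hk
  have hmain' : (Nat.card {g : BF n | g ∈ RM (r + 1) n ∧ (wt g : ℝ) ≤ 2^n * (1 - δ) / 2} : ℝ)
      ≤ 2 * 2 ^ ((n + 1) ^ r * (r + 4 + 2 * m)) := by exact_mod_cast hmain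
  refine hmain'.trans ?_
  rw [← hpow, ← Real.rpow_mul (by norm_num), ← pow_succ', ← Real.rpow_natCast]
  apply Real.rpow_le_rpow_of_exponent_le (by norm_num)
  push_cast
  have hn' : (1:ℝ) ≤ n := by exact_mod_cast hn
  have h1 : ((n:ℝ) + 1) ^ r ≤ 2 ^ r * n ^ r := by
    rw [← mul_pow]; gcongr; linarith
  have h2 : (1:ℝ) ≤ 2 ^ r * n ^ r := by
    rw [← mul_pow]; exact one_le_pow₀ (by linarith)
  have hr0 : (0:ℝ) ≤ r := by positivity
  have h3 : (r:ℝ) + 4 + 2 * m ≤ (r + 8) * L := by nlinarith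
  calc ((n:ℝ) + 1) ^ r * (r + 4 + 2 * m) + 1
      ≤ (2 ^ r * n ^ r) * ((r + 8) * L) + (2 ^ r * n ^ r) * L := by
        gcongr
        nlinarith
    _ = _ := by ring
end
end
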